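/- (Lemma 4.3, part 1.) Let W : G → ℂ be continuous, smooth, and satisfy W(v·g) = ψ_N(v)·W(g) for all v ∈ N, g ∈ G. Then for every g ∈ P': (i) for each x ∈ X'_n, the function v ↦ W(w_U·ι(g)·v·x) on U_♦ has compact support; (ii) the function x ↦ ∫_{U_♦} W(w_U·ι(g)·v·x)·ψ_♦(v)^{-1} dv on X'_n ≅ ℚ_p^n has compact support. In particular, the iterated integral ∫_{X'_n} ( ∫_{U_♦} W(w_U·ι(g)·v·x)·ψ_♦(v)^{-1} dv ) dx is an iterated integral of compactly supported functions, hence convergent. -/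

import Mathlib

open MeasureTheory Matrix

noncomputable instance (p : ℕ) [Fact p.Prime] : MeasurableSpace ℚ_[p] := borel _
instance (p : ℕ) [Fact p.Prime] : BorelSpace ℚ_[p] := ⟨rfl⟩
noncomputable instance matrixMeasurableSpace {α : Type*} [MeasurableSpace α] {m n : Type*} :
    MeasurableSpace (Matrix m n α) := MeasurableSpace.pi

/-- The `k × k` antidiagonal matrix `w_k` (ones on the antidiagonal, zeros elsewhere). -/
noncomputable def wa (p : ℕ) [Fact p.Prime] (k : ℕ) : Matrix (Fin k) (Fin k) ℚ_[p] :=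
  Matrix.of fun i j => if (i : ℕ) + (j : ℕ) = k - 1 then 1 else 0

/-- Identification of `Fin k ⊕ Fin k` with `Fin (2 * k)`. -/
def sumEquiv (k : ℕ) : (Fin k ⊕ Fin k) ≃ Fin (2 * k) :=
  finSumFinEquiv.trans (finCongr (by omega))

/-- The `2k × 2k` matrix built from four `k × k` blocks. -/
noncomputable def blk (p : ℕ) [Fact p.Prime] {k : ℕ} (A B C D : Matrix (Fin k) (Fin k) ℚ_[p]) :
    Matrix (Fin (2 * k)) (Fin (2 * k)) ℚ_[p] :=
  Matrix.reindex (sumEquiv k) (sumEquiv k) (Matrix.fromBlocks A B C D)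

/-- The symplectic form matrix `J = [[0, w_{2n}], [-w_{2n}, 0]]` of size `4n`. -/
noncomputable def Jmat (p : ℕ) [Fact p.Prime] (n : ℕ) :
    Matrix (Fin (2 * (2 * n))) (Fin (2 * (2 * n))) ℚ_[p] :=
  blk p 0 (wa p (2 * n)) (-(wa p (2 * n))) 0

/-- The group `G = {g ∈ GL_{4n}(ℚ_p) : gᵀ J g = J}`, described at the level of matrices. -/
def SpM (p : ℕ) [Fact p.Prime] (n : ℕ) :
    Set (Matrix (Fin (2 * (2 * n))) (Fin (2 * (2 * n))) ℚ_[p]) :=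
  {g | gᵀ * Jmat p n * g = Jmat p n}

/-- The symplectic form matrix `J' = [[0, wₙ], [-wₙ, 0]]` of size `2n`. -/
noncomputable def J2mat (p : ℕ) [Fact p.Prime] (n : ℕ) :
    Matrix (Fin (2 * n)) (Fin (2 * n)) ℚ_[p] :=
  blk p 0 (wa p n) (-(wa p n)) 0

/-- The group `G' = {g ∈ GL_{2n}(ℚ_p) : gᵀ J' g = J'}`, described at the level of matrices. -/
def Sp2M (p : ℕ) [Fact p.Prime] (n : ℕ) : Set (Matrix (Fin (2 * n)) (Fin (2 * n)) ℚ_[p]) :=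
  {g | gᵀ * J2mat p n * g = J2mat p n}

/-- The Siegel parabolic subgroup `P'` of `G'`: elements of `G'` whose lower-left `n × n`
block vanishes. -/
def SiegelP (p : ℕ) [Fact p.Prime] (n : ℕ) : Set (Matrix (Fin (2 * n)) (Fin (2 * n)) ℚ_[p]) :=
  {g | g ∈ Sp2M p n ∧ ∀ i j : Fin (2 * n), n ≤ (i : ℕ) → (j : ℕ) < n → g i j = 0}

/-- The embedding `ι : G' → G`, `ι(g) = diag(Iₙ, g, Iₙ)`. -/
noncomputable def iotaMat (p : ℕ) [Fact p.Prime] (n : ℕ)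
    (g : Matrix (Fin (2 * n)) (Fin (2 * n)) ℚ_[p]) :
    Matrix (Fin (2 * (2 * n))) (Fin (2 * (2 * n))) ℚ_[p] :=
  Matrix.of fun i j =>
    if hi : n ≤ (i : ℕ) ∧ (i : ℕ) < 3 * n then
      if hj : n ≤ (j : ℕ) ∧ (j : ℕ) < 3 * n then
        g ⟨(i : ℕ) - n, by omega⟩ ⟨(j : ℕ) - n, by omega⟩
      else 0
    else if (i : ℕ) = (j : ℕ) then 1 else 0

/-- The Weyl element `w_U = [[0, I_{2n}], [-I_{2n}, 0]]`. -/
noncomputable def wU (p : ℕ) [Fact p.Prime] (n : ℕ) :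
    Matrix (Fin (2 * (2 * n))) (Fin (2 * (2 * n))) ℚ_[p] :=
  blk p 0 1 (-1) 0

/-- `g` is upper triangular with all diagonal entries equal to `1`. -/
def IsUnipUpper {R : Type*} [Zero R] [One R] {m : ℕ} (g : Matrix (Fin m) (Fin m) R) : Prop :=
  (∀ i j : Fin m, (j : ℕ) < (i : ℕ) → g i j = 0) ∧ ∀ i : Fin m, g i i = 1

/-- The sum `g_{1,2} + g_{2,3} + ⋯ + g_{k,k+1}` of the first `k` superdiagonal entries of `g`
(1-based indexing); the argument of `ψ` in the character `ψ_N`. -/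
noncomputable def sdSumUpTo {R : Type*} [AddCommMonoid R] (m k : ℕ)
    (g : Matrix (Fin m) (Fin m) R) : R :=
  ∑ i : Fin k, if h : (i : ℕ) + 1 < m then g ⟨(i : ℕ), by omega⟩ ⟨(i : ℕ) + 1, h⟩ else 0

/-- The additive group `Rₙ` of `n × n` matrices whose first column vanishes. -/
def RnSub (p : ℕ) [Fact p.Prime] (n : ℕ) : AddSubgroup (Matrix (Fin n) (Fin n) ℚ_[p]) where
  carrier := {x | ∀ i j : Fin n, (j : ℕ) = 0 → x i j = 0}
  add_mem' := by
    intro a b ha hb i j hj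
    simp [Matrix.add_apply, ha i j hj, hb i j hj]
  zero_mem' := by intro i j hj; simp
  neg_mem' := by
    intro a ha i j hj
    simp [Matrix.neg_apply, ha i j hj]

/-- The additive group `Sₙ = {y : wₙ yᵀ wₙ = y}`. -/
def SnSub (p : ℕ) [Fact p.Prime] (n : ℕ) : AddSubgroup (Matrix (Fin n) (Fin n) ℚ_[p]) where
  carrier := {y | wa p n * yᵀ * wa p n = y}
  add_mem' := by
    intro a b ha hb
    simp only [Set.mem_setOf_eq] at *
    rw [Matrix.transpose_add, Matrix.mul_add, Matrix.add_mul, ha, hb]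
  zero_mem' := by simp
  neg_mem' := by
    intro a ha
    simp only [Set.mem_setOf_eq] at *
    rw [Matrix.transpose_neg, Matrix.mul_neg, Matrix.neg_mul, ha]

/-- The inner `2n × 2n` matrix `z = [[x*, y], [0, x]]`. -/
noncomputable def zDiam (p : ℕ) [Fact p.Prime] {n : ℕ} (x y : Matrix (Fin n) (Fin n) ℚ_[p]) :
    Matrix (Fin (2 * n)) (Fin (2 * n)) ℚ_[p] :=
  blk p (wa p n * xᵀ * wa p n) y 0 x

/-- The element `u(z) = [[I_{2n}, z], [0, I_{2n}]]` of `U_♦`, for `z = [[x*, y], [0, x]]`. -/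
noncomputable def uDiamond (p : ℕ) [Fact p.Prime] {n : ℕ} (x y : Matrix (Fin n) (Fin n) ℚ_[p]) :
    Matrix (Fin (2 * (2 * n))) (Fin (2 * (2 * n))) ℚ_[p] :=
  blk p 1 (zDiam p x y) 0 1

/-- The argument `(1/2) · z_{n,n+1}` of `ψ` in the character `ψ_♦` evaluated at `u(z)`,
`z = [[x*, y], [0, x]]` (the indices are 1-based; for `n = 0` the value is irrelevant). -/
noncomputable def psiDiamondArg (p : ℕ) [Fact p.Prime] {n : ℕ}
    (x y : Matrix (Fin n) (Fin n) ℚ_[p]) : ℚ_[p] :=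
  if h : 1 ≤ n then (2 : ℚ_[p])⁻¹ * zDiam p x y ⟨n - 1, by omega⟩ ⟨n, by omega⟩ else 0

/-- The `n × n` matrix which vanishes outside its last row, which is `a`. -/
noncomputable def lastRowMat (p : ℕ) [Fact p.Prime] {n : ℕ} (a : Fin n → ℚ_[p]) :
    Matrix (Fin n) (Fin n) ℚ_[p] :=
  Matrix.of fun i j => if (i : ℕ) = n - 1 then a j else 0

/-- The element `u([[x, 0], [0, x*]])` of `X'ₙ` attached to `a ∈ ℚ_p^n`, where `x` is the
matrix whose only (possibly) nonzero row is its last row `a`. -/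
noncomputable def xPrimeMat (p : ℕ) [Fact p.Prime] {n : ℕ} (a : Fin n → ℚ_[p]) :
    Matrix (Fin (2 * (2 * n))) (Fin (2 * (2 * n))) ℚ_[p] :=
  blk p 1 (blk p (lastRowMat p a) 0 0 (wa p n * (lastRowMat p a)ᵀ * wa p n)) 0 1

section MaxMinor

variable {K ι : Type*} [NormedField K] [Fintype ι]

/-- The maximal norm of the `j × j` minors of the first `j` vectors of the sequence `f`. -/
noncomputable def maxMinor (f : ℕ → ι → K) (j : ℕ) : ℝ :=
  ⨆ e : Fin j → ι, ‖det (of fun i k : Fin j => f i (e k))‖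

theorem norm_det_le_maxMinor_fin (f : ℕ → ι → K) (j : ℕ) (e : Fin j → ι) :
    ‖det (of fun i k : Fin j => f i (e k))‖ ≤ maxMinor f j :=
  le_ciSup (f := fun e : Fin j → ι => ‖det (of fun i k : Fin j => f i (e k))‖)
    (Set.finite_range _).bddAbove e

theorem exists_norm_det_eq_maxMinor [Nonempty ι] (f : ℕ → ι → K) (j : ℕ) :
    ∃ e : Fin j → ι, ‖det (of fun i k : Fin j => f i (e k))‖ = maxMinor f j :=
  exists_eq_ciSup_of_finite

theorem maxMinor_zero [Nonempty ι] (f : ℕ → ι → K) : maxMinor f 0 = 1 := by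
  obtain ⟨e, he⟩ := exists_norm_det_eq_maxMinor f 0
  rw [← he]; simp

theorem norm_det_le_maxMinor {κ : Type*} [Fintype κ] [DecidableEq κ] (f : ℕ → ι → K) {j : ℕ}
    (ρ : κ ≃ Fin j) (e : κ → ι) :
    ‖det (of fun i k : κ => f (ρ i) (e k))‖ ≤ maxMinor f j := by
  refine le_trans (le_of_eq ?_) (norm_det_le_maxMinor_fin f j (e ∘ ρ.symm))
  rw [← det_reindex_self ρ]
  congr 2
  ext i k
  simp

/-- Cofactor expansion along the last column: an integral combination of the first `j + 1` vectors
in which the last one has the largest possible coefficient. -/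
theorem exists_combination [Nonempty ι] (f : ℕ → ι → K) (j : ℕ) (hj : 0 < maxMinor f (j + 1)) :
    ∃ β : Fin (j + 1) → K, (∀ k, ‖∑ i : Fin (j + 1), β i * f i k‖ ≤ 1) ∧
      ‖β (Fin.last j)‖ = maxMinor f j / maxMinor f (j + 1) := by
  obtain ⟨e, he⟩ := exists_norm_det_eq_maxMinor f j
  obtain ⟨e', he'⟩ := exists_norm_det_eq_maxMinor f (j + 1)
  set M : K := det (of fun i k : Fin (j + 1) => f i (e' k)) with hM
  have hM0 : M ≠ 0 := by
    intro h
    rw [h, norm_zero] at he'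
    exact hj.ne he'
  let cof : Fin (j + 1) → K := fun t =>
    (-1) ^ ((t : ℕ) + j) * det (of fun i k : Fin j => f (t.succAbove i) (e k))
  refine ⟨fun t => cof t / M, fun k => ?_, ?_⟩
  · have h : ∑ i : Fin (j + 1), cof i / M * f i k =
        det (of fun i t : Fin (j + 1) => f i ((Fin.snoc e k : Fin (j + 1) → ι) t)) / M := by
      rw [det_succ_column _ (Fin.last j), Finset.sum_div]
      refine Finset.sum_congr rfl fun t _ => ?_
      have hsub : (of fun i t : Fin (j + 1) => f i ((Fin.snoc e k : Fin (j + 1) → ι) t)).submatrix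
          t.succAbove (Fin.last j).succAbove
          = of fun i k : Fin j => f (t.succAbove i) (e k) := by
        ext i k
        simp
      rw [hsub]
      simp [cof]
      ring
    rw [h, norm_div, div_le_one (norm_pos_iff.2 hM0), he']
    exact norm_det_le_maxMinor_fin f (j + 1) _
  · simp [cof, he, he']

variable [IsUltrametricDist K] [DecidableEq ι]

/-- Cofactor expansion along the last row: a functional with integral coefficients which kills the
first `j` vectors and takes the largest possible value on the next one. -/
theorem exists_functional [Nonempty ι] (f : ℕ → ι → K) (j : ℕ) (hj : 0 < maxMinor f j) :
    ∃ c : ι → K, (∀ k, ‖c k‖ ≤ 1) ∧ (∀ i < j, f i ⬝ᵥ c = 0) ∧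
      ‖f j ⬝ᵥ c‖ = maxMinor f (j + 1) / maxMinor f j := by
  obtain ⟨e, he⟩ := exists_norm_det_eq_maxMinor f j
  obtain ⟨e', he'⟩ := exists_norm_det_eq_maxMinor f (j + 1)
  set M : K := det (of fun i k : Fin j => f i (e k)) with hM
  have hM0 : M ≠ 0 := by
    intro h
    rw [h, norm_zero] at he
    exact hj.ne he
  let cof : Fin (j + 1) → K := fun t =>
    (-1) ^ (j + (t : ℕ)) * det (of fun i k : Fin j => f i (e' (t.succAbove k)))
  let c : ι → K := fun k => (∑ t, if e' t = k then cof t else 0) / M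
  have hval : ∀ v : ι → K, v ⬝ᵥ c =
      det (of fun i k : Fin (j + 1) => Function.update f j v i (e' k)) / M := by
    intro v
    rw [det_succ_row _ (Fin.last j)]
    simp only [c, dotProduct, mul_div_assoc', Finset.mul_sum, ← Finset.sum_div]
    rw [Finset.sum_comm]
    congr 1
    refine Finset.sum_congr rfl fun t _ => ?_
    have hsub : (of fun i k : Fin (j + 1) => Function.update f j v i (e' k)).submatrix
        (Fin.last j).succAbove t.succAbove
        = of fun i k : Fin j => f i (e' (t.succAbove k)) := by
      ext i k
      have : (i : ℕ) ≠ j := i.2.ne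
      simp [this]
    rw [hsub]
    simp [cof]
    ring
  refine ⟨c, fun k => ?_, fun i hi => ?_, ?_⟩
  · simp only [c, norm_div]
    rw [div_le_one (norm_pos_iff.2 hM0), he]
    refine IsUltrametricDist.norm_sum_le_of_forall_le_of_nonneg hj.le fun t _ => ?_
    split_ifs
    · simp only [cof, norm_mul, norm_pow, norm_neg, norm_one, one_pow, one_mul]
      exact norm_det_le_maxMinor_fin f j _
    · simpa using hj.le
  · rw [hval, div_eq_zero_iff]
    left
    refine det_zero_of_row_eq (i := ⟨i, by omega⟩) (j := Fin.last j) ?_ ?_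
    · intro h
      have := congrArg Fin.val h
      simp at this
      omega
    · ext k
      have : i ≠ j := hi.ne
      simp [this]
  · rw [hval, norm_div, he, ← he']
    congr 3
    ext i k
    simp

end MaxMinor

/-- A positive sequence which is log-concave up to a constant and satisfies
`d n * d (n + 1) ≤ d (2 * n)` is bounded at `2 * n`. -/
theorem exists_bound_of_logConcave (C : ℝ) (hC : 1 ≤ C) (n : ℕ) (hn : 1 ≤ n) :
    ∃ B : ℝ, ∀ d : ℕ → ℝ, (∀ j, j ≤ 2 * n → 0 < d j) → d 0 = 1 →
      (∀ j, j + 2 ≤ 2 * n → d (j + 2) * d j ≤ C * d (j + 1) ^ 2) →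
      d n * d (n + 1) ≤ d (2 * n) → d (2 * n) ≤ B := by
  refine ⟨(C ^ (2 * n) * C ^ (n * (n - 1))) ^ (2 * n), fun d hpos h0 hlc hprod => ?_⟩
  have hC0 : (0 : ℝ) < C := by linarith
  have hr : ∀ l k, k + l + 1 ≤ 2 * n →
      d (k + l + 1) / d (k + l) ≤ C ^ l * (d (k + 1) / d k) := by
    intro l
    induction l with
    | zero => intro k hk; simp
    | succ l ih =>
      intro k hk
      have h1 := ih k (by omega)
      have h2 : d (k + (l + 1) + 1) / d (k + (l + 1)) ≤ C * (d (k + l + 1) / d (k + l)) := by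
        have a := hpos (k + l) (by omega)
        have b := hpos (k + (l + 1)) (by omega)
        rw [div_le_iff₀ b, mul_div_assoc', div_mul_eq_mul_div, le_div_iff₀ a]
        have := hlc (k + l) (by omega)
        calc _ = d (k + l + 2) * d (k + l) := by ring_nf
          _ ≤ _ := this
          _ = _ := by rw [show k + (l + 1) = k + l + 1 by ring]; ring
      calc _ ≤ _ := h2
        _ ≤ C * (C ^ l * (d (k + 1) / d k)) := by gcongr
        _ = _ := by ring
  have hk : ∀ k, k ≤ n - 1 → d (n + 1 + k) * d 1 ≤ C ^ (n * k) * (d (n + 1) * d (1 + k)) := by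
    intro k
    induction k with
    | zero => intro _; simp
    | succ k ih =>
      intro hk
      have h1 := ih (by omega)
      have h2 := hr n (1 + k) (by omega)
      have a := hpos (1 + k) (by omega)
      have b := hpos (n + 1 + k) (by omega)
      have b' := hpos (n + 1 + (k + 1)) (by omega)
      have a' := hpos (1 + (k + 1)) (by omega)
      rw [show 1 + k + n + 1 = n + 1 + (k + 1) by ring, show 1 + k + n = n + 1 + k by ring,
        show 1 + k + 1 = 1 + (k + 1) by ring] at h2
      calc d (n + 1 + (k + 1)) * d 1
          = (d (n + 1 + (k + 1)) / d (n + 1 + k)) * (d (n + 1 + k) * d 1) := by field_simp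
        _ ≤ (C ^ n * (d (1 + (k + 1)) / d (1 + k))) *
              (C ^ (n * k) * (d (n + 1) * d (1 + k))) := by
            have := hpos 1 (by omega)
            gcongr
        _ = _ := by
            field_simp
            ring
  have hd1 : d 1 ≤ C ^ (n * (n - 1)) := by
    have h1 := hk (n - 1) le_rfl
    rw [show n + 1 + (n - 1) = 2 * n by omega, show 1 + (n - 1) = n by omega] at h1
    have h2n := hpos (2 * n) le_rfl
    have : d (2 * n) * d 1 ≤ d (2 * n) * C ^ (n * (n - 1)) := by
      calc _ ≤ _ := h1
        _ ≤ C ^ (n * (n - 1)) * d (2 * n) := by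
          gcongr
          linarith
        _ = _ := by ring
    exact le_of_mul_le_mul_left this h2n
  set Q := C ^ (2 * n) * C ^ (n * (n - 1)) with hQ
  have hQ0 : 0 < Q := by positivity
  have hdk : ∀ k, k ≤ 2 * n → d k ≤ Q ^ k := by
    intro k
    induction k with
    | zero => intro _; simp [h0]
    | succ k ih =>
      intro hk'
      have h1 := ih (by omega)
      have h2 := hr k 0 (by omega)
      have a := hpos k (by omega)
      simp only [zero_add, h0, div_one] at h2
      rw [div_le_iff₀ a] at h2
      calc d (k + 1) ≤ _ := h2
        _ ≤ (C ^ (2 * n) * C ^ (n * (n - 1))) * Q ^ k := by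
            have := hpos 1 (by omega)
            gcongr
            omega
        _ = _ := by rw [← hQ]; ring
  exact hdk _ le_rfl

section BlockMinors

variable {K : Type*} [NormedField K]

theorem maxMinor_comp_equiv {ι ι' : Type*} (f : ℕ → ι → K) (φ : ι' ≃ ι)
    (j : ℕ) : maxMinor (fun i k => f i (φ k)) j = maxMinor f j :=
  (Equiv.arrowCongr (Equiv.refl (Fin j)) φ).iSup_congr fun e => by simp

theorem norm_le_maxMinor_of_dual {ι : Type*} [Fintype ι] (f : ℕ → ι → K) {j : ℕ} (q : Fin j → ι)
    (hq : ∀ i k : Fin j, f i (q k) = if i = k then 1 else 0) (i : Fin j) (c : ι) :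
    ‖f i c‖ ≤ maxMinor f j := by
  refine le_trans (le_of_eq ?_) (norm_det_le_maxMinor_fin f j (Function.update q i c))
  have h : (of fun a k : Fin j => f a (Function.update q i c k))
      = (1 : Matrix (Fin j) (Fin j) K).updateCol i (fun a => f a c) := by
    ext a k
    by_cases hk : k = i
    · subst hk; simp
    · simp [hk, hq, one_apply]
  rw [h, ← cramer_apply, cramer_one]
  simp

/-- Complementary minors: a maximal minor of `[1 x]` is, up to sign, a maximal minor of `[1 xᵀ]`. -/
theorem exists_norm_det_transpose_eq {κ : Type*} [Fintype κ] [DecidableEq κ] (x : Matrix κ κ K)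
    (e : κ → κ ⊕ κ) (he : Function.Injective e) :
    ∃ e' : κ → κ ⊕ κ, ‖det (of fun i k => fromCols 1 xᵀ i (e' k))‖
      = ‖det (of fun i k => fromCols 1 x i (e k))‖ := by
  obtain ⟨σ, hσ⟩ : ∃ σ : κ ⊕ κ ≃ κ ⊕ κ, ∀ k, σ (Sum.inl k) = e k := by
    obtain ⟨g, hg⟩ := Finset.exists_equiv_extend_of_card_eq (α := κ ⊕ κ) (β := κ ⊕ κ)
      (t := Finset.univ) (by simp) (s := Finset.univ.map ⟨Sum.inl, Sum.inl_injective⟩)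
      (f := Sum.elim e e) (Finset.subset_univ _) (by
        intro a ha b hb hab
        simp only [Finset.coe_map, Function.Embedding.coeFn_mk, Finset.coe_univ,
          Set.image_univ, Set.mem_range] at ha hb
        obtain ⟨a, rfl⟩ := ha
        obtain ⟨b, rfl⟩ := hb
        simpa using he hab)
    refine ⟨g.trans (Equiv.subtypeUnivEquiv (by simp)), fun k => ?_⟩
    simpa using hg (Sum.inl k) (by simp)
  set G : Matrix (κ ⊕ κ) (κ ⊕ κ) K := fromBlocks 1 x 0 1 with hG
  set G' : Matrix (κ ⊕ κ) (κ ⊕ κ) K := fromBlocks 1 (-x) 0 1 with hG'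
  have hGG' : G * G' = 1 := by
    simp [hG, hG', fromBlocks_multiply]
  set M := G.submatrix id σ with hM
  set R := G'.submatrix σ id with hR
  have hMR : M * R = 1 := by
    rw [hM, hR, submatrix_mul_equiv, hGG', submatrix_id_id]
  have hA : M.toBlocks₁₁ = of fun i k => fromCols 1 x i (e k) := by
    ext i k
    rcases h : e k <;> simp [hM, toBlocks₁₁, hσ, h, hG]
  have key : M * fromBlocks 1 R.toBlocks₁₂ 0 R.toBlocks₂₂ =
      fromBlocks M.toBlocks₁₁ 0 M.toBlocks₂₁ 1 := by
    have h1 := hMR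
    rw [← fromBlocks_toBlocks M, ← fromBlocks_toBlocks R, fromBlocks_multiply,
      ← fromBlocks_one, fromBlocks_inj] at h1
    conv_lhs => rw [← fromBlocks_toBlocks M]
    rw [fromBlocks_multiply]
    simp [h1.2.1, h1.2.2.2]
  have hdet := congrArg det key
  rw [det_mul, det_fromBlocks_zero₂₁, det_fromBlocks_zero₁₂, det_one, one_mul, mul_one,
    hA, hM, det_permute', hG, det_fromBlocks_zero₂₁, det_one, mul_one, mul_one] at hdet
  rw [← hdet]
  have hsign : ‖(((Equiv.Perm.sign σ : ℤˣ) : ℤ) : K)‖ = 1 := by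
    rcases Int.units_eq_one_or (Equiv.Perm.sign σ) with h | h <;> simp [h]
  rw [norm_mul, hsign, one_mul, ← det_transpose]
  refine ⟨fun k => (σ (Sum.inr k)).swap, ?_⟩
  have hcol : R.toBlocks₂₂ᵀ = of fun i k => (Sum.elim (fun _ => -1) (fun _ => 1) (σ (Sum.inr k))) *
      (of fun i k => fromCols 1 xᵀ i ((σ (Sum.inr k)).swap)) i k := by
    ext i k
    rcases h : σ (Sum.inr k) with r | r
    · simp [hR, toBlocks₂₂, h, hG']
    · simp [hR, toBlocks₂₂, h, hG', one_apply, eq_comm]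
  rw [hcol, det_mul_row, norm_mul, norm_prod]
  rw [Finset.prod_eq_one, one_mul]
  intro k _
  rcases σ (Sum.inr k) <;> simp

/-- The rows of `[[1, 0], [Z, 1]]`, `Z = [[X, y], [0, x]]`, taken from the bottom. -/
structure IsLowerRows {n : ℕ} (f : ℕ → (Fin n ⊕ Fin n) ⊕ (Fin n ⊕ Fin n) → K)
    (X y x : Matrix (Fin n) (Fin n) K) : Prop where
  bottom (i : Fin n) : f i =
    Sum.elim (Sum.elim (0 : Fin n → K) (x i.rev)) (Sum.elim (0 : Fin n → K) (Pi.single i.rev 1))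
  top (i : Fin n) :
    f (n + i) =
    Sum.elim (Sum.elim (X i.rev) (y i.rev)) (Sum.elim (Pi.single i.rev 1) (0 : Fin n → K))

namespace IsLowerRows

variable {n : ℕ} {f : ℕ → (Fin n ⊕ Fin n) ⊕ (Fin n ⊕ Fin n) → K}
  {X y x : Matrix (Fin n) (Fin n) K}

theorem exists_dual (hf : IsLowerRows f X y x) :
    ∃ q : Fin (n + n) → (Fin n ⊕ Fin n) ⊕ (Fin n ⊕ Fin n),
      ∀ i k : Fin (n + n), f i (q k) = if i = k then 1 else 0 := by
  refine ⟨fun k => Sum.elim (fun a => Sum.inr (Sum.inr a.rev)) (fun a => Sum.inr (Sum.inl a.rev))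
    (finSumFinEquiv.symm k), fun i k => ?_⟩
  obtain ⟨i, rfl⟩ := finSumFinEquiv.surjective i
  obtain ⟨k, rfl⟩ := finSumFinEquiv.surjective k
  have hb := hf.bottom
  have ht := hf.top
  simp only [Equiv.symm_apply_apply, EmbeddingLike.apply_eq_iff_eq]
  rcases i with i | i <;> rcases k with k | k <;>
    simp only [finSumFinEquiv_apply_left, finSumFinEquiv_apply_right, Fin.val_castAdd,
      Fin.val_natAdd, hb, ht] <;>
    simp [Pi.single_apply, eq_comm]

theorem norm_le_maxMinor (hf : IsLowerRows f X y x) {j : ℕ} (hj : j ≤ n + n) (i : Fin j) (c) :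
    ‖f i c‖ ≤ maxMinor f j := by
  obtain ⟨q, hq⟩ := hf.exists_dual
  refine norm_le_maxMinor_of_dual f (fun k => q (k.castLE hj)) (fun i k => ?_) i c
  have := hq (i.castLE hj) (k.castLE hj)
  simpa [Fin.ext_iff] using this

theorem maxMinor_pos (hf : IsLowerRows f X y x) {j : ℕ} (hj : j ≤ n + n) : 0 < maxMinor f j := by
  rcases Nat.eq_zero_or_pos j with rfl | h
  · rcases Nat.eq_zero_or_pos n with rfl | hn
    · unfold maxMinor
      simp
    · have : Nonempty ((Fin n ⊕ Fin n) ⊕ (Fin n ⊕ Fin n)) := ⟨Sum.inl (Sum.inl ⟨0, hn⟩)⟩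
      rw [maxMinor_zero]; exact one_pos
  · obtain ⟨q, hq⟩ := hf.exists_dual
    refine lt_of_lt_of_le one_pos (le_trans (le_of_eq ?_)
      (hf.norm_le_maxMinor hj ⟨0, h⟩ (q ⟨0, by omega⟩)))
    have := hq ⟨0, by omega⟩ ⟨0, by omega⟩
    simp only [if_true] at this
    rw [this, norm_one]

end IsLowerRows

variable [IsUltrametricDist K]

theorem IsLowerRows.maxMinor_mul_le {m : ℕ}
    {f : ℕ → (Fin (m + 1) ⊕ Fin (m + 1)) ⊕ (Fin (m + 1) ⊕ Fin (m + 1)) → K}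
    {X y x : Matrix (Fin (m + 1)) (Fin (m + 1)) K} (hf : IsLowerRows f X y x)
    (hx : ∀ i k, x i k = X k.rev i.rev) (hX : ∀ k, X (Fin.last m) k = 0) :
    maxMinor f (m + 1) * maxMinor f (m + 1 + 1) ≤ maxMinor f (m + 1 + (m + 1)) := by
  have hne : Nonempty ((Fin (m + 1) ⊕ Fin (m + 1)) ⊕ (Fin (m + 1) ⊕ Fin (m + 1))) :=
    ⟨Sum.inl (Sum.inl 0)⟩
  have hpos := hf.maxMinor_pos (j := m + 1) (by omega)
  obtain ⟨e, he⟩ := exists_norm_det_eq_maxMinor f (m + 1)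
  have hcol0 : ∀ k, ¬ ∀ i : Fin (m + 1), f i (e k) = 0 := by
    intro k hk
    rw [det_eq_zero_of_column_eq_zero k (by simpa using hk), norm_zero] at he
    exact hpos.ne he
  have hbl : ∀ k, ∃ c : Fin (m + 1) ⊕ Fin (m + 1),
      e k = Sum.elim (fun r => Sum.inr (Sum.inr r)) (fun r => Sum.inl (Sum.inr r)) c := by
    intro k
    have h := hcol0 k
    rcases hk : e k with (r | r) | (r | r)
    · exact absurd (fun i => by rw [hf.bottom, hk]; rfl) h
    · exact ⟨Sum.inr r, rfl⟩
    · exact absurd (fun i => by rw [hf.bottom, hk]; rfl) h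
    · exact ⟨Sum.inl r, rfl⟩
  choose c hc using hbl
  have hdet1 : ‖det (of fun i k => fromCols 1 x i (c k))‖ = maxMinor f (m + 1) := by
    have hzero : ‖det ((of fun i k => fromCols 1 x i (c k)).submatrix Fin.revPerm id)‖ =
        maxMinor f (m + 1) := by
      rw [← he]
      congr 2
      ext i k
      rcases h : c k with r | r <;>
        simp [hf.bottom, hc, h, Pi.single_apply, one_apply, eq_comm]
    rw [← hzero, det_permute, norm_mul]
    rcases Int.units_eq_one_or (Equiv.Perm.sign (Fin.revPerm : Equiv.Perm (Fin (m + 1))))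
      with h | h <;> simp [h]
  have hcinj : Function.Injective c := by
    intro a b hab
    by_contra hne'
    rw [det_zero_of_column_eq hne' (by intro i; simp [hab]), norm_zero] at hdet1
    exact hpos.ne hdet1
  obtain ⟨e', he'⟩ := exists_norm_det_transpose_eq x c hcinj
  rw [hdet1] at he'
  obtain ⟨c', hdet2⟩ : ∃ c' : Fin (m + 1) → Fin (m + 1) ⊕ Fin (m + 1),
      ‖det (of fun i k => fromCols 1 X i (c' k))‖ = maxMinor f (m + 1) := by
    refine ⟨fun k => Sum.map Fin.rev Fin.rev (e' k.rev), ?_⟩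
    rw [← he', ← det_submatrix_equiv_self Fin.revPerm (of fun i k => fromCols 1 X i _)]
    congr 2
    ext i k
    rcases h : e' k with r | r
    · simp [h, one_apply, Fin.rev_inj]
    · simp [h, hx]
  obtain ⟨k₀, hk₀⟩ : ∃ k₀ : Fin (m + 1), maxMinor f (m + 1) ≤
      ‖det (of fun i k : Fin m => fromCols 1 X i.castSucc (c' (k₀.succAbove k)))‖ := by
    by_contra! hlt
    obtain ⟨k₁, hk₁⟩ := Finite.exists_max fun k₀ : Fin (m + 1) =>
      ‖det (of fun i k : Fin m => fromCols 1 X i.castSucc (c' (k₀.succAbove k)))‖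
    refine absurd hdet2 (ne_of_lt (lt_of_le_of_lt ?_ (hlt k₁)))
    rw [det_succ_row _ (Fin.last m)]
    refine IsUltrametricDist.norm_sum_le_of_forall_le_of_nonneg (norm_nonneg _) fun t _ => ?_
    have hent : ‖(of fun i k => fromCols 1 X i (c' k)) (Fin.last m) t‖ ≤ 1 := by
      rcases h : c' t with r | r
      · simp only [of_apply, h, fromCols_apply_inl, one_apply]
        split_ifs <;> simp
      · simp [h, hX]
    calc _ ≤ 1 * 1 * ‖((of fun i k => fromCols 1 X i (c' k)).submatrix (Fin.last m).succAbove
            t.succAbove).det‖ := by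
          rw [norm_mul, norm_mul]
          gcongr
          simp
      _ ≤ _ := by
          rw [one_mul, one_mul]
          refine le_trans (le_of_eq ?_) (hk₁ t)
          congr 2
          ext i k
          simp
  obtain ⟨e₂, he₂⟩ := exists_norm_det_eq_maxMinor f (m + 1 + 1)
  -- the columns used by the top rows never meet the last row of the upper half
  have hlast : ∀ k : Fin m, c' (k₀.succAbove k) ≠ Sum.inl (Fin.last m) := by
    intro k hk
    rw [det_eq_zero_of_column_eq_zero k (by
      intro i
      simp [hk, one_apply]), norm_zero] at hk₀
    linarith
  let ρ : Fin m ⊕ Fin (m + 1 + 1) ≃ Fin (m + 1 + (m + 1)) :=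
    ((Fin.revPerm.sumCongr (Equiv.refl _)).trans (Equiv.sumComm _ _)).trans
      (finSumFinEquiv.trans (finCongr (by omega)))
  have hρl : ∀ i : Fin m, ((ρ (Sum.inl i) : Fin _) : ℕ) = m + 1 + ((i.castSucc.rev : Fin (m + 1)) : ℕ) := by
    intro i
    simp [ρ]
    omega
  have hρr : ∀ i, ((ρ (Sum.inr i) : Fin _) : ℕ) = i := by
    intro i
    simp [ρ]
  let E : Fin m ⊕ Fin (m + 1 + 1) → (Fin (m + 1) ⊕ Fin (m + 1)) ⊕ (Fin (m + 1) ⊕ Fin (m + 1)) :=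
    Sum.elim (fun k => Sum.elim (fun r => Sum.inr (Sum.inl r)) (fun r => Sum.inl (Sum.inl r))
      (c' (k₀.succAbove k))) e₂
  refine le_trans ?_ (norm_det_le_maxMinor f ρ E)
  have hblock : (of fun i k => f (ρ i) (E k)) = fromBlocks
      (of fun i k : Fin m => fromCols 1 X i.castSucc (c' (k₀.succAbove k)))
      (of fun (i : Fin m) (k : Fin (m + 1 + 1)) => f (ρ (Sum.inl i)) (e₂ k)) 0
      (of fun i k : Fin (m + 1 + 1) => f i (e₂ k)) := by
    ext i k
    rcases i with i | i <;> rcases k with k | k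
    · simp only [of_apply, hρl, hf.top, fromBlocks_apply₁₁]
      rcases h : c' (k₀.succAbove k) with r | r <;>
        simp [E, h, Pi.single_apply, one_apply, eq_comm]
    · simp [E]
    · have hl := hlast k
      simp only [of_apply, hρr, fromBlocks_apply₂₁]
      induction i using Fin.lastCases with
      | last =>
        have := hf.top 0
        simp only [Fin.val_zero, add_zero] at this
        rw [Fin.val_last, this]
        rcases h : c' (k₀.succAbove k) with r | r
        · rw [h] at hl
          have hr : r ≠ Fin.last m := fun hr => hl (by rw [hr])
          simp [E, h, hr]
        · simp [E, h, hX]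
      | cast i =>
        rw [Fin.val_castSucc, hf.bottom]
        rcases h : c' (k₀.succAbove k) with r | r <;> simp [E, h]
    · simp [E, hρr]
  rw [hblock, det_fromBlocks_zero₂₁, norm_mul, he₂]
  gcongr
  exact (hf.maxMinor_pos (by omega)).le

end BlockMinors

section Blocks

variable {p : ℕ} [Fact p.Prime]

theorem wa_apply (k : ℕ) (i j : Fin k) : wa p k i j = if i = j.rev then 1 else 0 := by
  have h : (i : ℕ) + j = k - 1 ↔ i = j.rev := by rw [Fin.ext_iff, Fin.val_rev]; omega
  simp [wa, h]

@[simp]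
theorem mul_wa_apply {k : ℕ} {ι : Type*} (x : Matrix ι (Fin k) ℚ_[p]) (i : ι) (j : Fin k) :
    (x * wa p k) i j = x i j.rev := by
  simp [mul_apply, wa_apply]

@[simp]
theorem wa_mul_apply {k : ℕ} {ι : Type*} (x : Matrix (Fin k) ι ℚ_[p]) (i : Fin k) (j : ι) :
    (wa p k * x) i j = x i.rev j := by
  simp [mul_apply, wa_apply, ← Fin.rev_eq_iff]

theorem wa_transpose (k : ℕ) : (wa p k)ᵀ = wa p k := by
  ext i j
  have h : j = i.rev ↔ i = j.rev := by constructor <;> rintro rfl <;> simp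
  simp [wa_apply, h]

theorem wa_mul_wa (k : ℕ) : wa p k * wa p k = 1 := by
  ext i j
  simp [wa_apply, one_apply]

theorem wa_mul_cancel (k : ℕ) {ι : Type*} (x : Matrix (Fin k) ι ℚ_[p]) :
    wa p k * (wa p k * x) = x := by
  ext i j
  simp

/-- The transpose about the antidiagonal. -/
noncomputable def antiT {k : ℕ} (x : Matrix (Fin k) (Fin k) ℚ_[p]) : Matrix (Fin k) (Fin k) ℚ_[p] :=
  wa p k * xᵀ * wa p k

theorem antiT_apply {k : ℕ} (x : Matrix (Fin k) (Fin k) ℚ_[p]) (i j : Fin k) :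
    antiT x i j = x j.rev i.rev := by
  simp [antiT]

theorem antiT_antiT {k : ℕ} (x : Matrix (Fin k) (Fin k) ℚ_[p]) : antiT (antiT x) = x := by
  ext i j
  simp [antiT_apply]

theorem antiT_mul {k : ℕ} (x y : Matrix (Fin k) (Fin k) ℚ_[p]) :
    antiT (x * y) = antiT y * antiT x := by
  ext i j
  simp only [antiT_apply, mul_apply]
  exact Fintype.sum_equiv Fin.revPerm _ _ fun k => by simp [mul_comm]

theorem antiT_add {k : ℕ} (x y : Matrix (Fin k) (Fin k) ℚ_[p]) :
    antiT (x + y) = antiT x + antiT y := by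
  ext i j
  simp [antiT_apply]

theorem antiT_neg {k : ℕ} (x : Matrix (Fin k) (Fin k) ℚ_[p]) : antiT (-x) = -antiT x := by
  ext i j
  simp [antiT_apply]

theorem blk_mul {k : ℕ} (A B C D A' B' C' D' : Matrix (Fin k) (Fin k) ℚ_[p]) :
    blk p A B C D * blk p A' B' C' D' =
      blk p (A * A' + B * C') (A * B' + B * D') (C * A' + D * C') (C * B' + D * D') := by
  simp [blk, ← fromBlocks_multiply, submatrix_mul_equiv]

theorem blk_transpose {k : ℕ} (A B C D : Matrix (Fin k) (Fin k) ℚ_[p]) :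
    (blk p A B C D)ᵀ = blk p Aᵀ Cᵀ Bᵀ Dᵀ := by
  simp [blk, ← fromBlocks_transpose]

theorem blk_neg {k : ℕ} (A B C D : Matrix (Fin k) (Fin k) ℚ_[p]) :
    -blk p A B C D = blk p (-A) (-B) (-C) (-D) := by
  rw [blk, blk, ← fromBlocks_neg]; rfl

theorem blk_add {k : ℕ} (A B C D A' B' C' D' : Matrix (Fin k) (Fin k) ℚ_[p]) :
    blk p A B C D + blk p A' B' C' D' = blk p (A + A') (B + B') (C + C') (D + D') := by
  rw [blk, blk, blk, ← fromBlocks_add]; rfl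

theorem blk_one {k : ℕ} : blk p 1 0 0 1 = (1 : Matrix (Fin (2 * k)) (Fin (2 * k)) ℚ_[p]) := by
  simp [blk]

theorem blk_inj {k : ℕ} {A B C D A' B' C' D' : Matrix (Fin k) (Fin k) ℚ_[p]}
    (h : blk p A B C D = blk p A' B' C' D') : A = A' ∧ B = B' ∧ C = C' ∧ D = D' := by
  rw [blk, blk, (reindex (sumEquiv k) (sumEquiv k)).injective.eq_iff] at h
  exact fromBlocks_inj.1 h

theorem exists_eq_blk {k : ℕ} (M : Matrix (Fin (2 * k)) (Fin (2 * k)) ℚ_[p]) :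
    ∃ A B C D, M = blk p A B C D := by
  refine ⟨_, _, _, _, ((reindex (sumEquiv k) (sumEquiv k)).symm_apply_eq).1
    (fromBlocks_toBlocks ((reindex (sumEquiv k) (sumEquiv k)).symm M)).symm⟩

theorem blk_apply {k : ℕ} (A B C D : Matrix (Fin k) (Fin k) ℚ_[p]) (i j : Fin k ⊕ Fin k) :
    blk p A B C D (sumEquiv k i) (sumEquiv k j) = fromBlocks A B C D i j := by
  simp [blk]

@[simp]
theorem sumEquiv_inl_val {k : ℕ} (i : Fin k) : (sumEquiv k (Sum.inl i) : ℕ) = i := by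
  simp [sumEquiv]

@[simp]
theorem sumEquiv_inr_val {k : ℕ} (i : Fin k) : (sumEquiv k (Sum.inr i) : ℕ) = k + i := by
  simp [sumEquiv, add_comm]

theorem rev_sumEquiv_inl {k : ℕ} (i : Fin k) :
    (sumEquiv k (Sum.inl i)).rev = sumEquiv k (Sum.inr i.rev) := by
  ext; simp [Fin.val_rev]; omega

theorem rev_sumEquiv_inr {k : ℕ} (i : Fin k) :
    (sumEquiv k (Sum.inr i)).rev = sumEquiv k (Sum.inl i.rev) := by
  ext; simp [Fin.val_rev]; omega

theorem antiT_blk {k : ℕ} (A B C D : Matrix (Fin k) (Fin k) ℚ_[p]) :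
    antiT (blk p A B C D) = blk p (antiT D) (antiT B) (antiT C) (antiT A) := by
  ext i j
  obtain ⟨i, rfl⟩ := (sumEquiv k).surjective i
  obtain ⟨j, rfl⟩ := (sumEquiv k).surjective j
  rw [antiT_apply]
  rcases i with i | i <;> rcases j with j | j <;>
    simp [rev_sumEquiv_inl, rev_sumEquiv_inr, blk_apply, antiT_apply]

end Blocks

section Symplectic

variable {p : ℕ} [Fact p.Prime] {n : ℕ}

theorem Jmat_transpose : (Jmat p n)ᵀ = -Jmat p n := by
  simp [Jmat, blk_transpose, blk_neg, wa_transpose]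

theorem Jmat_mul_Jmat : Jmat p n * Jmat p n = -1 := by
  rw [← blk_one, blk_neg]
  simp [Jmat, blk_mul, wa_mul_wa]

theorem Jmat_apply (i j : Fin (2 * (2 * n))) :
    Jmat p n i j = if i = j.rev then (if (i : ℕ) < 2 * n then 1 else -1) else 0 := by
  obtain ⟨i, rfl⟩ := (sumEquiv _).surjective i
  obtain ⟨j, rfl⟩ := (sumEquiv _).surjective j
  rw [Jmat, blk_apply]
  rcases i with i | i <;> rcases j with j | j <;>
    simp [rev_sumEquiv_inl, rev_sumEquiv_inr, wa_apply]
  split_ifs <;> simp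

theorem Jmat_mulVec_apply (b : Fin (2 * (2 * n)) → ℚ_[p]) (i) :
    (Jmat p n *ᵥ b) i = (if (i : ℕ) < 2 * n then 1 else -1) * b i.rev := by
  simp [mulVec, dotProduct, Jmat_apply, ← Fin.rev_eq_iff]

theorem vecMul_Jmat_apply (c : Fin (2 * (2 * n)) → ℚ_[p]) (i) :
    (c ᵥ* Jmat p n) i = (if (i : ℕ) < 2 * n then -1 else 1) * c i.rev := by
  simp only [vecMul, dotProduct, Jmat_apply, mul_ite, mul_zero, Finset.sum_ite_eq', Finset.mem_univ,
    if_true, Fin.val_rev]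
  split_ifs <;> first | omega | simp

theorem mul_mem_SpM {g h : Matrix _ _ ℚ_[p]} (hg : g ∈ SpM p n) (hh : h ∈ SpM p n) :
    g * h ∈ SpM p n := by
  simp only [SpM, Set.mem_ofPred_eq, transpose_mul] at *
  calc hᵀ * gᵀ * Jmat p n * (g * h) = hᵀ * (gᵀ * Jmat p n * g) * h := by
        simp only [Matrix.mul_assoc]
    _ = _ := by rw [hg, hh]

theorem exists_inv_of_mem_SpM {h : Matrix _ _ ℚ_[p]} (hh : h ∈ SpM p n) :
    ∃ h' ∈ SpM p n, h * h' = 1 ∧ h' * h = 1 := by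
  have h1 : -(Jmat p n * hᵀ * Jmat p n) * h = 1 := by
    rw [Matrix.neg_mul, Matrix.mul_assoc, Matrix.mul_assoc, ← Matrix.mul_assoc hᵀ,
      show hᵀ * Jmat p n * h = Jmat p n from hh, Jmat_mul_Jmat, neg_neg]
  have h2 := mul_eq_one_comm.1 h1
  refine ⟨_, ?_, h2, h1⟩
  set h' := -(Jmat p n * hᵀ * Jmat p n)
  show h'ᵀ * Jmat p n * h' = _
  calc h'ᵀ * Jmat p n * h' = h'ᵀ * (hᵀ * Jmat p n * h) * h' := by
        rw [show hᵀ * Jmat p n * h = Jmat p n from hh]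
    _ = (h * h')ᵀ * Jmat p n * (h * h') := by
        rw [transpose_mul]; simp only [Matrix.mul_assoc]
    _ = _ := by simp [h2]

theorem mul_Jmat_mul_transpose {h : Matrix _ _ ℚ_[p]} (hh : h ∈ SpM p n) :
    h * Jmat p n * hᵀ = Jmat p n := by
  have h1 : -(Jmat p n * hᵀ * Jmat p n) * h = 1 := by
    rw [Matrix.neg_mul, Matrix.mul_assoc, Matrix.mul_assoc, ← Matrix.mul_assoc hᵀ,
      show hᵀ * Jmat p n * h = Jmat p n from hh, Jmat_mul_Jmat, neg_neg]
  have h2 := congrArg (· * Jmat p n) (mul_eq_one_comm.1 h1)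
  simpa [Matrix.mul_assoc, Jmat_mul_Jmat] using h2

/-- The symplectic transvection-like element `1 + s (c bᵀ + (J b) (cᵀ J))`. -/
noncomputable def transv (s : ℚ_[p]) (c b : Fin (2 * (2 * n)) → ℚ_[p]) :
    Matrix (Fin (2 * (2 * n))) (Fin (2 * (2 * n))) ℚ_[p] :=
  1 + s • (vecMulVec c b + vecMulVec (Jmat p n *ᵥ b) (c ᵥ* Jmat p n))

theorem dotProduct_Jmat_mulVec_self (b : Fin (2 * (2 * n)) → ℚ_[p]) :
    b ⬝ᵥ Jmat p n *ᵥ b = 0 := by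
  have h : b ⬝ᵥ Jmat p n *ᵥ b = -(b ⬝ᵥ Jmat p n *ᵥ b) := by
    conv_lhs => rw [dotProduct_mulVec, dotProduct_comm, ← mulVec_transpose, Jmat_transpose,
      neg_mulVec, dotProduct_neg]
  exact self_eq_neg.1 h

theorem transv_mem (s : ℚ_[p]) {c b : Fin (2 * (2 * n)) → ℚ_[p]} (hbc : b ⬝ᵥ c = 0) :
    transv s c b ∈ SpM p n := by
  have hJJ (x : Fin (2 * (2 * n)) → ℚ_[p]) : Jmat p n *ᵥ (Jmat p n *ᵥ x) = -x := by
    rw [mulVec_mulVec, Jmat_mul_Jmat, neg_mulVec, one_mulVec]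
  have hcJ : c ᵥ* Jmat p n = -(Jmat p n *ᵥ c) := by
    rw [← mulVec_transpose, Jmat_transpose, neg_mulVec]
  have hcb : c ⬝ᵥ b = 0 := by rw [dotProduct_comm, hbc]
  set Y := vecMulVec c b + vecMulVec (Jmat p n *ᵥ b) (c ᵥ* Jmat p n) with hY
  have h1 : Yᵀ * Jmat p n = vecMulVec b (c ᵥ* Jmat p n) + vecMulVec (c ᵥ* Jmat p n) b := by
    rw [hY, transpose_add, transpose_vecMulVec, transpose_vecMulVec, Matrix.add_mul,
      vecMulVec_mul, vecMulVec_mul]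
    congr 2
    rw [← mulVec_transpose, Jmat_transpose, neg_mulVec, hJJ, neg_neg]
  have h2 : Jmat p n * Y = -(Yᵀ * Jmat p n) := by
    rw [h1, hY, Matrix.mul_add, mul_vecMulVec, mul_vecMulVec, hJJ, hcJ]
    simp only [neg_vecMulVec, vecMulVec_neg]
    abel
  have h3 : Yᵀ * Jmat p n * Y = 0 := by
    have e1 : (c ᵥ* Jmat p n) ⬝ᵥ c = 0 := by
      rw [← dotProduct_mulVec, dotProduct_Jmat_mulVec_self]
    have e2 : (c ᵥ* Jmat p n) ⬝ᵥ (Jmat p n *ᵥ b) = 0 := by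
      rw [← dotProduct_mulVec, hJJ, dotProduct_neg, hcb, neg_zero]
    rw [h1, hY]
    simp only [Matrix.mul_add, Matrix.add_mul, vecMulVec_mul_vecMulVec, e1, e2, hbc,
      dotProduct_Jmat_mulVec_self]
    simp
  show (transv s c b)ᵀ * Jmat p n * transv s c b = _
  rw [transv, ← hY, transpose_add, transpose_smul, transpose_one]
  simp only [Matrix.mul_add, Matrix.add_mul, Matrix.smul_mul, Matrix.mul_smul, h2, h3,
    Matrix.mul_one, Matrix.one_mul]
  simp

theorem mul_transv {h : Matrix _ _ ℚ_[p]} (hh : h ∈ SpM p n) (s : ℚ_[p])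
    (c β : Fin (2 * (2 * n)) → ℚ_[p]) :
    h * transv s c (β ᵥ* h) = transv s (h *ᵥ c) β * h := by
  have hJ : hᵀ * Jmat p n * h = Jmat p n := hh
  simp only [transv, Matrix.mul_add, Matrix.add_mul, Matrix.mul_one, Matrix.one_mul,
    Matrix.mul_smul, Matrix.smul_mul, mul_vecMulVec, vecMulVec_mul]
  congr 4
  · rw [← mulVec_transpose h β, mulVec_mulVec, mulVec_mulVec, mul_Jmat_mul_transpose hh]
  · conv_lhs => rw [← hJ]
    rw [← vecMul_vecMul, ← vecMul_vecMul, vecMul_transpose]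

end Symplectic

section Criterion

variable {p : ℕ} [Fact p.Prime] {n : ℕ}

theorem transv_apply (s : ℚ_[p]) (c b : Fin (2 * (2 * n)) → ℚ_[p]) (t u) :
    transv s c b t u = (1 : Matrix _ _ ℚ_[p]) t u +
      s * (c t * b u + (Jmat p n *ᵥ b) t * (c ᵥ* Jmat p n) u) := rfl

theorem isUnipUpper_transv (s : ℚ_[p]) {c b : Fin (2 * (2 * n)) → ℚ_[p]} {i : ℕ}
    (hb : ∀ u, i < (u.rev : ℕ) → b u = 0)
    (hc : ∀ t, (t.rev : ℕ) ≤ i → c t = 0) : IsUnipUpper (transv s c b) := by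
  have key : ∀ t u : Fin (2 * (2 * n)), (u : ℕ) ≤ t →
      c t * b u + (Jmat p n *ᵥ b) t * (c ᵥ* Jmat p n) u = 0 := by
    intro t u hut
    have h1 : c t * b u = 0 := by
      by_cases h : i < (u.rev : ℕ)
      · rw [hb u h, mul_zero]
      · rw [hc t (by rw [Fin.val_rev] at *; omega), zero_mul]
    have h2 : b t.rev * c u.rev = 0 := by
      by_cases h : i < (t : ℕ)
      · rw [hb t.rev (by rwa [Fin.rev_rev]), zero_mul]
      · rw [hc u.rev (by rw [Fin.rev_rev]; omega), mul_zero]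
    rw [h1, Jmat_mulVec_apply, vecMul_Jmat_apply, zero_add, mul_mul_mul_comm, h2, mul_zero]
  constructor
  · intro t u hut
    have hne : t ≠ u := by rintro rfl; exact lt_irrefl _ hut
    rw [transv_apply, key t u hut.le, one_apply_ne hne, mul_zero, add_zero]
  · intro t
    rw [transv_apply, key t t le_rfl, one_apply_eq, mul_zero, add_zero]

theorem sdSumUpTo_transv (s : ℚ_[p]) {c b : Fin (2 * (2 * n)) → ℚ_[p]} {i : ℕ}
    (hi : i + 2 ≤ 2 * n) (hb : ∀ u, i < (u.rev : ℕ) → b u = 0)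
    (hc : ∀ t, (t.rev : ℕ) ≤ i → c t = 0) :
    sdSumUpTo (2 * (2 * n)) (2 * n - 1) (transv s c b) =
      s * -(b (Fin.rev ⟨i, by omega⟩) * c (Fin.rev ⟨i + 1, by omega⟩)) := by
  rw [sdSumUpTo, Fintype.sum_eq_single ⟨i, by omega⟩]
  · rw [dif_pos (by simp only; omega)]
    have h1 : b ⟨i + 1, by omega⟩ = 0 := hb _ (by rw [Fin.val_rev]; simp only; omega)
    rw [transv_apply, Jmat_mulVec_apply, vecMul_Jmat_apply, h1,
      one_apply_ne (by simp), if_pos (by simp only; omega), if_pos (by simp only; omega)]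
    simp
  · intro t ht
    have hti : (t : ℕ) ≠ i := fun h => ht (Fin.ext h)
    have ht2 := t.2
    rw [dif_pos (by omega)]
    have h1 : b ⟨t + 1, by omega⟩ = 0 := hb _ (by rw [Fin.val_rev]; simp only; omega)
    have h2 : b (Fin.rev ⟨t, by omega⟩) * c (Fin.rev ⟨t + 1, by omega⟩) = 0 := by
      rcases lt_or_gt_of_ne hti with h | h
      · rw [hc _ (by rw [Fin.rev_rev]; exact h), mul_zero]
      · rw [hb _ (by rw [Fin.rev_rev]; exact h), zero_mul]
    rw [transv_apply, Jmat_mulVec_apply, vecMul_Jmat_apply, h1,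
      one_apply_ne (by simp), mul_mul_mul_comm, h2]
    simp

/-- A right-smooth `(N, ψ_N)`-equivariant function on the symplectic group. -/
structure IsWhittaker (ψ : ℚ_[p] → ℂˣ)
    (W : Matrix (Fin (2 * (2 * n))) (Fin (2 * (2 * n))) ℚ_[p] → ℂ) : Prop where
  smooth : ∀ᶠ r in nhds 1, r ∈ SpM p n → ∀ h ∈ SpM p n, W (h * r) = W h
  equivariant : ∀ v ∈ SpM p n, ∀ h ∈ SpM p n, IsUnipUpper v →
    W (v * h) = (ψ (sdSumUpTo (2 * (2 * n)) (2 * n - 1) v) : ℂ) * W h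

theorem IsWhittaker.translate {ψ : ℚ_[p] → ℂˣ}
    {W : Matrix (Fin (2 * (2 * n))) (Fin (2 * (2 * n))) ℚ_[p] → ℂ} (hW : IsWhittaker ψ W)
    {κ : Matrix (Fin (2 * (2 * n))) (Fin (2 * (2 * n))) ℚ_[p]} (hκ : κ ∈ SpM p n) :
    IsWhittaker ψ fun h => W (h * κ) := by
  obtain ⟨κ', hκ', h1, h2⟩ := exists_inv_of_mem_SpM hκ
  refine ⟨?_, fun v hv h hh hu => ?_⟩
  · have ht : Filter.Tendsto (fun r => κ' * r * κ) (nhds 1) (nhds 1) := by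
      have : Continuous fun r => κ' * r * κ := by fun_prop
      simpa [h2] using this.tendsto 1
    filter_upwards [ht.eventually hW.smooth] with r hr hrS h hh
    rw [← hr (mul_mem_SpM (mul_mem_SpM hκ' hrS) hκ) _ (mul_mem_SpM hh hκ)]
    congr 1
    calc h * r * κ = h * (κ * κ') * r * κ := by rw [h1, Matrix.mul_one]
      _ = _ := by simp only [Matrix.mul_assoc]
  · rw [Matrix.mul_assoc]
    exact hW.equivariant v hv _ (mul_mem_SpM hh hκ) hu

theorem norm_le_of_forall_eq_one {ψ : ℚ_[p] → ℂˣ} {s₁ : ℚ_[p]} (hs₁ : ψ s₁ ≠ 1) {ε : ℝ} (hε : 0 < ε)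
    {l : ℚ_[p]} (h : ∀ s : ℚ_[p], ‖s‖ ≤ ε → ψ (s * l) = 1) : ‖l‖ ≤ ‖s₁‖ / ε := by
  by_contra! hlt
  have hl : 0 < ‖l‖ := lt_of_le_of_lt (by positivity) hlt
  have hl' : l ≠ 0 := norm_pos_iff.1 hl
  refine hs₁ ?_
  have := h (s₁ / l) ?_
  · rwa [div_mul_cancel₀ _ hl'] at this
  · rw [norm_div, div_le_iff₀ hl]
    rw [div_lt_iff₀ hε] at hlt
    linarith

/-- The rows of a matrix, listed from the bottom. -/
noncomputable def rowsFromBelow {N : ℕ} (h : Matrix (Fin N) (Fin N) ℚ_[p]) (i : ℕ) : Fin N → ℚ_[p] :=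
  if hi : i < N then h (Fin.rev ⟨i, hi⟩) else 0

theorem IsWhittaker.eventually_transv {ψ : ℚ_[p] → ℂˣ}
    {W : Matrix (Fin (2 * (2 * n))) (Fin (2 * (2 * n))) ℚ_[p] → ℂ} (hW : IsWhittaker ψ W) :
    ∃ ε > 0, ∀ s : ℚ_[p], ‖s‖ ≤ ε → ∀ c b : Fin (2 * (2 * n)) → ℚ_[p], (∀ k, ‖c k‖ ≤ 1) →
      (∀ k, ‖b k‖ ≤ 1) → transv s c b ∈ SpM p n →
      ∀ h ∈ SpM p n, W (h * transv s c b) = W h := by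
  have hK : IsCompact (Metric.closedBall (0 : (Fin (2 * (2 * n)) → ℚ_[p]) ×
      (Fin (2 * (2 * n)) → ℚ_[p])) 1) := isCompact_closedBall _ _
  have hc : Continuous fun z : ℚ_[p] × (Fin (2 * (2 * n)) → ℚ_[p]) ×
      (Fin (2 * (2 * n)) → ℚ_[p]) => transv z.1 z.2.1 z.2.2 := by
    unfold transv
    fun_prop
  have key := hK.eventually_forall_of_forall_eventually (x₀ := (0 : ℚ_[p]))
    (P := fun s cb => transv s cb.1 cb.2 ∈ SpM p n →
      ∀ h ∈ SpM p n, W (h * transv s cb.1 cb.2) = W h) fun cb _ => by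
    have ht := hc.tendsto (0, cb)
    simp only [transv, zero_smul, add_zero] at ht
    exact ht.eventually hW.smooth
  obtain ⟨ε, hε, h⟩ := (Metric.nhds_basis_closedBall.eventually_iff).1 key
  refine ⟨ε, hε, fun s hs c b hc hb => h (by simpa using hs) (c, b) ?_⟩
  simp only [mem_closedBall_zero_iff, Prod.norm_def, sup_le_iff]
  exact ⟨(pi_norm_le_iff_of_nonneg zero_le_one).2 hc, (pi_norm_le_iff_of_nonneg zero_le_one).2 hb⟩

theorem IsWhittaker.exists_logConcave {ψ : ℚ_[p] → ℂˣ} (hψ : ∃ a, ψ a ≠ 1)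
    {W : Matrix (Fin (2 * (2 * n))) (Fin (2 * (2 * n))) ℚ_[p] → ℂ} (hW : IsWhittaker ψ W) :
    ∃ C : ℝ, 1 ≤ C ∧ ∀ h ∈ SpM p n, W h ≠ 0 →
      (∀ j ≤ 2 * n, 0 < maxMinor (rowsFromBelow h) j) → ∀ j, j + 2 ≤ 2 * n →
      maxMinor (rowsFromBelow h) (j + 2) * maxMinor (rowsFromBelow h) j ≤
        C * maxMinor (rowsFromBelow h) (j + 1) ^ 2 := by
  obtain ⟨s₁, hs₁⟩ := hψ
  obtain ⟨ε, hε, H⟩ := hW.eventually_transv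
  refine ⟨max 1 (‖s₁‖ / ε), le_max_left _ _, fun h hh hWh hpos j hj => ?_⟩
  have : Nonempty (Fin (2 * (2 * n))) := ⟨⟨0, by omega⟩⟩
  set f := rowsFromBelow h with hf
  obtain ⟨c, hc1, hc0, hcj⟩ := exists_functional f (j + 1) (hpos _ (by omega))
  obtain ⟨β', hβ1, hβj⟩ := exists_combination f j (hpos _ (by omega))
  set β : Fin (2 * (2 * n)) → ℚ_[p] := fun u =>
    if hu : (u.rev : ℕ) < j + 1 then β' ⟨u.rev, hu⟩ else 0 with hβ
  have hrow : ∀ t : Fin (2 * (2 * n)), f (t.rev : ℕ) = h t := by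
    intro t
    rw [hf, rowsFromBelow, dif_pos t.rev.2, Fin.eta, Fin.rev_rev]
  have hα : ∀ t : Fin (2 * (2 * n)), (h *ᵥ c) t = f (t.rev : ℕ) ⬝ᵥ c := by
    intro t
    rw [hrow]; rfl
  have hβh : ∀ k, (β ᵥ* h) k = ∑ i, β' i * f i k := by
    intro k
    simp only [vecMul, dotProduct]
    symm
    refine Fintype.sum_of_injective
      (fun i : Fin (j + 1) => Fin.rev (⟨i, by omega⟩ : Fin (2 * (2 * n)))) ?_ _ _ ?_ ?_
    · intro a b hab
      simpa only [Fin.rev_inj, Fin.mk.injEq, ← Fin.ext_iff] using hab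
    · intro u hu
      have : ¬ (u.rev : ℕ) < j + 1 := fun hlt => hu ⟨⟨u.rev, hlt⟩, Fin.rev_rev u⟩
      simp only [hβ, dif_neg this, zero_mul]
    · intro i
      have h1 : ((Fin.rev (Fin.rev (⟨i, by omega⟩ : Fin (2 * (2 * n))))  : Fin _) : ℕ) = i := by
        rw [Fin.rev_rev]
      rw [← hrow, h1]
      simp only [hβ]
      rw [dif_pos (by rw [h1]; exact i.2)]
      congr 2
      exact Fin.ext h1.symm
  have hb0 : ∀ u, j < (u.rev : ℕ) → β u = 0 := fun u hu => dif_neg (by omega)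
  have ha0 : ∀ t, (t.rev : ℕ) ≤ j → (h *ᵥ c) t = 0 := fun t ht => by
    rw [hα, hc0 _ (by omega)]
  have hdot : β ⬝ᵥ (h *ᵥ c) = 0 := by
    refine Finset.sum_eq_zero fun u _ => ?_
    rcases lt_or_ge j (u.rev : ℕ) with h' | h'
    · rw [hb0 u h', zero_mul]
    · rw [ha0 u h', mul_zero]
  have hl := norm_le_of_forall_eq_one hs₁ hε (l :=
      -(β (Fin.rev ⟨j, by omega⟩) * (h *ᵥ c) (Fin.rev ⟨j + 1, by omega⟩))) fun s hs => by
    have e1 := H s hs c (β ᵥ* h) hc1 (fun k => by rw [hβh]; exact hβ1 k)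
      (transv_mem s (by rw [← dotProduct_mulVec, hdot])) h hh
    rw [mul_transv hh, hW.equivariant _ (transv_mem s hdot) h hh
      (isUnipUpper_transv s hb0 ha0), sdSumUpTo_transv s hj hb0 ha0] at e1
    exact Units.ext (mul_right_cancel₀ hWh (by rw [e1, Units.val_one, one_mul]))
  have e2 : β (Fin.rev ⟨j, by omega⟩) = β' (Fin.last j) := by
    simp only [hβ]
    rw [dif_pos (by simp)]
    congr 1
    ext; simp
  rw [norm_neg, norm_mul, e2, hβj, hα, Fin.rev_rev, hcj] at hl
  have hp := hpos (j + 1) (by omega)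
  rw [div_mul_div_comm, div_le_iff₀ (by positivity)] at hl
  calc _ = maxMinor f j * maxMinor f (j + 1 + 1) := mul_comm _ _
    _ ≤ _ := hl
    _ ≤ max 1 (‖s₁‖ / ε) * (maxMinor f (j + 1) * maxMinor f (j + 1)) := by
        gcongr; exact le_max_right _ _
    _ = _ := by ring

end Criterion

section LowerUnipotent

variable {p : ℕ} [Fact p.Prime] {n : ℕ}

/-- The lower unipotent matrix `[[1, 0], [Z, 1]]`. -/
noncomputable def lowerU (Z : Matrix (Fin (2 * n)) (Fin (2 * n)) ℚ_[p]) :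
    Matrix (Fin (2 * (2 * n))) (Fin (2 * (2 * n))) ℚ_[p] :=
  blk p 1 0 Z 1

/-- The upper unipotent matrix `[[1, Z], [0, 1]]`. -/
noncomputable def upperU (Z : Matrix (Fin (2 * n)) (Fin (2 * n)) ℚ_[p]) :
    Matrix (Fin (2 * (2 * n))) (Fin (2 * (2 * n))) ℚ_[p] :=
  blk p 1 Z 0 1

/-- The block matrix `[[X, y], [0, X*]]`. -/
noncomputable def zz (X y : Matrix (Fin n) (Fin n) ℚ_[p]) :
    Matrix (Fin (2 * n)) (Fin (2 * n)) ℚ_[p] :=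
  blk p X y 0 (antiT X)

theorem antiT_zero (k : ℕ) : antiT (0 : Matrix (Fin k) (Fin k) ℚ_[p]) = 0 := by
  simp [antiT]

theorem antiT_zz {X y : Matrix (Fin n) (Fin n) ℚ_[p]} (hy : antiT y = y) :
    antiT (zz X y) = zz X y := by
  rw [zz, antiT_blk, antiT_antiT, hy, antiT_zero]

theorem wa_mul_eq_of_antiT {k : ℕ} {Z : Matrix (Fin k) (Fin k) ℚ_[p]} (hZ : antiT Z = Z) :
    wa p k * Z = Zᵀ * wa p k := by
  conv_lhs => rw [← hZ, antiT, Matrix.mul_assoc, wa_mul_cancel]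

theorem lowerU_mem {Z : Matrix (Fin (2 * n)) (Fin (2 * n)) ℚ_[p]} (hZ : antiT Z = Z) :
    lowerU Z ∈ SpM p n := by
  show (lowerU Z)ᵀ * Jmat p n * lowerU Z = Jmat p n
  simp [lowerU, Jmat, blk_mul, blk_transpose, wa_mul_eq_of_antiT hZ]

theorem upperU_mem {Z : Matrix (Fin (2 * n)) (Fin (2 * n)) ℚ_[p]} (hZ : antiT Z = Z) :
    upperU Z ∈ SpM p n := by
  show (upperU Z)ᵀ * Jmat p n * upperU Z = Jmat p n
  simp [upperU, Jmat, blk_mul, blk_transpose, wa_mul_eq_of_antiT hZ]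

theorem lowerU_mul (Z Z' : Matrix (Fin (2 * n)) (Fin (2 * n)) ℚ_[p]) :
    lowerU Z * lowerU Z' = lowerU (Z + Z') := by
  simp [lowerU, blk_mul]

theorem upperU_mul (Z Z' : Matrix (Fin (2 * n)) (Fin (2 * n)) ℚ_[p]) :
    upperU Z * upperU Z' = upperU (Z + Z') := by
  simp [upperU, blk_mul, add_comm]

theorem zz_add (X y X' y' : Matrix (Fin n) (Fin n) ℚ_[p]) :
    zz X y + zz X' y' = zz (X + X') (y + y') := by
  simp [zz, blk_add, antiT_add]

/-- The four-block index set of `4n × 4n` matrices. -/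
def quadEquiv (n : ℕ) : (Fin n ⊕ Fin n) ⊕ (Fin n ⊕ Fin n) ≃ Fin (2 * (2 * n)) :=
  ((sumEquiv n).sumCongr (sumEquiv n)).trans (sumEquiv (2 * n))

theorem isLowerRows_lowerU (X y : Matrix (Fin n) (Fin n) ℚ_[p]) :
    IsLowerRows (fun i k => rowsFromBelow (lowerU (zz X y)) i (quadEquiv n k)) X y (antiT X) where
  bottom i := by
    ext k
    have h : (⟨i, by omega⟩ : Fin (2 * (2 * n))).rev =
        sumEquiv (2 * n) (Sum.inr (sumEquiv n (Sum.inr i.rev))) := by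
      ext; simp only [Fin.val_rev, sumEquiv_inr_val]; omega
    rw [rowsFromBelow, dif_pos (by omega), h]
    rcases k with (k | k) | (k | k) <;>
      simp [quadEquiv, lowerU, zz, blk_apply, one_apply, Pi.single_apply, eq_comm]
  top i := by
    ext k
    have h : (⟨n + i, by omega⟩ : Fin (2 * (2 * n))).rev =
        sumEquiv (2 * n) (Sum.inr (sumEquiv n (Sum.inl i.rev))) := by
      ext; simp only [Fin.val_rev, sumEquiv_inr_val, sumEquiv_inl_val]; omega
    rw [rowsFromBelow, dif_pos (by omega), h]
    rcases k with (k | k) | (k | k) <;>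
      simp [quadEquiv, lowerU, zz, blk_apply, one_apply, Pi.single_apply, eq_comm]

theorem IsWhittaker.exists_bound {ψ : ℚ_[p] → ℂˣ} (hψ : ∃ a, ψ a ≠ 1) (hn : 1 ≤ n)
    {W : Matrix (Fin (2 * (2 * n))) (Fin (2 * (2 * n))) ℚ_[p] → ℂ} (hW : IsWhittaker ψ W) :
    ∃ B : ℝ, ∀ X y : Matrix (Fin n) (Fin n) ℚ_[p], (∀ i k : Fin n, (i : ℕ) = n - 1 → X i k = 0) →
      antiT y = y → W (lowerU (zz X y)) ≠ 0 → ∀ i k, ‖X i k‖ ≤ B ∧ ‖y i k‖ ≤ B := by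
  obtain ⟨C, hC, H⟩ := hW.exists_logConcave hψ
  obtain ⟨B, hB⟩ := exists_bound_of_logConcave C hC n hn
  refine ⟨B, fun X y hX hy hne => ?_⟩
  have hf := isLowerRows_lowerU X y
  set f : ℕ → (Fin n ⊕ Fin n) ⊕ (Fin n ⊕ Fin n) → ℚ_[p] :=
    fun i k => rowsFromBelow (lowerU (zz X y)) i (quadEquiv n k) with hfdef
  have hd : ∀ j, maxMinor f j = maxMinor (rowsFromBelow (lowerU (zz X y))) j :=
    fun j => maxMinor_comp_equiv _ _ _
  have hpos : ∀ j ≤ 2 * n, 0 < maxMinor f j := fun j hj => hf.maxMinor_pos (by omega)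
  have hle : maxMinor f (2 * n) ≤ B := by
    refine hB (maxMinor f) hpos ?_ ?_ ?_
    · have : Nonempty ((Fin n ⊕ Fin n) ⊕ (Fin n ⊕ Fin n)) := ⟨Sum.inl (Sum.inl ⟨0, hn⟩)⟩
      exact maxMinor_zero f
    · intro j hj
      simp only [hd]
      refine H _ (lowerU_mem (antiT_zz hy)) hne (fun j hj => ?_) j hj
      rw [← hd]
      exact hpos j hj
    · obtain ⟨m, rfl⟩ : ∃ m, n = m + 1 := ⟨n - 1, by omega⟩
      rw [two_mul]
      exact hf.maxMinor_mul_le (fun i k => antiT_apply X i k) fun k => hX _ _ (by simp)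
  have hent : ∀ (i : ℕ), i < n + n → ∀ c, ‖f i c‖ ≤ B := fun i hi c =>
    (hf.norm_le_maxMinor (j := n + n) le_rfl ⟨i, hi⟩ c).trans (by rwa [← two_mul])
  intro i k
  have ht := hf.top i.rev
  rw [Fin.rev_rev] at ht
  constructor
  · have := hent (n + (i.rev : ℕ)) (by omega) (Sum.inl (Sum.inl k))
    rw [ht] at this
    exact this
  · have := hent (n + (i.rev : ℕ)) (by omega) (Sum.inl (Sum.inr k))
    rw [ht] at this
    exact this

end LowerUnipotent

section SiegelFactor

variable {p : ℕ} [Fact p.Prime] {n : ℕ}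

theorem wa_two_mul (k : ℕ) : wa p (2 * k) = blk p 0 (wa p k) (wa p k) 0 := by
  ext i j
  obtain ⟨i, rfl⟩ := (sumEquiv k).surjective i
  obtain ⟨j, rfl⟩ := (sumEquiv k).surjective j
  rw [wa_apply, blk_apply]
  rcases i with i | i <;> rcases j with j | j <;>
    simp [rev_sumEquiv_inl, rev_sumEquiv_inr, wa_apply]

theorem iotaMat_blk {A B D : Matrix (Fin n) (Fin n) ℚ_[p]} :
    iotaMat p n (blk p A B 0 D) =
      blk p (blk p 1 0 0 A) (blk p 0 0 B 0) 0 (blk p D 0 0 1) := by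
  have hA (i j : Fin n) (h₁ h₂) : blk p A B 0 D ⟨(i : ℕ), h₁⟩ ⟨(j : ℕ), h₂⟩ = A i j := by
    rw [← fromBlocks_apply₁₁ A B 0 D i j, ← blk_apply]
    congr 1
  have hB (i j : Fin n) (h₁ h₂) : blk p A B 0 D ⟨(i : ℕ), h₁⟩ ⟨2 * n + (j : ℕ) - n, h₂⟩ = B i j := by
    rw [← fromBlocks_apply₁₂ A B 0 D i j, ← blk_apply]
    congr 1 <;> ext <;> simp <;> omega
  have hD (i j : Fin n) (h₁ h₂) :
      blk p A B 0 D ⟨2 * n + (i : ℕ) - n, h₁⟩ ⟨2 * n + (j : ℕ) - n, h₂⟩ = D i j := by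
    rw [← fromBlocks_apply₂₂ A B 0 D i j, ← blk_apply]
    congr 1 <;> ext <;> simp <;> omega
  have hC (i j : Fin n) (h₁ h₂) :
      blk p A B 0 D ⟨2 * n + (i : ℕ) - n, h₁⟩ ⟨(j : ℕ), h₂⟩ = 0 := by
    rw [← show fromBlocks A B 0 D (Sum.inr i) (Sum.inl j) = 0 from rfl, ← blk_apply]
    congr 1 <;> ext <;> simp <;> omega
  ext i j
  obtain ⟨i, rfl⟩ := (quadEquiv n).surjective i
  obtain ⟨j, rfl⟩ := (quadEquiv n).surjective j
  rcases i with (i | i) | (i | i) <;> rcases j with (j | j) | (j | j) <;>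
    simp [quadEquiv, iotaMat, blk_apply, one_apply, Fin.ext_iff] <;>
    (try intros) <;> (try split_ifs) <;>
    first
    | omega
    | rfl
    | exact hA i j _ _
    | exact hB i j _ _
    | exact hC i j _ _
    | exact hD i j _ _

theorem exists_blk_of_mem_SiegelP {g : Matrix (Fin (2 * n)) (Fin (2 * n)) ℚ_[p]}
    (hg : g ∈ SiegelP p n) : ∃ A B D, g = blk p A B 0 D ∧ Aᵀ * (wa p n * D) = wa p n ∧
      Bᵀ * (wa p n * D) = Dᵀ * (wa p n * B) := by
  obtain ⟨A, B, C, D, rfl⟩ := exists_eq_blk g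
  have hC : C = 0 := by
    ext i j
    have := hg.2 (sumEquiv n (Sum.inr i)) (sumEquiv n (Sum.inl j)) (by simp) (by simp)
    rwa [blk_apply] at this
  subst hC
  have h := hg.1
  simp only [Sp2M, J2mat, Set.mem_ofPred_eq, blk_transpose, blk_mul, Matrix.mul_assoc] at h
  obtain ⟨-, h1, -, h2⟩ := blk_inj h
  refine ⟨A, B, D, rfl, by simpa using h1, ?_⟩
  simpa [add_neg_eq_zero] using h2

theorem wU_mem : wU p n ∈ SpM p n := by
  show (wU p n)ᵀ * Jmat p n * wU p n = Jmat p n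
  simp [wU, Jmat, blk_mul, blk_transpose]

theorem iotaMat_mem {g : Matrix (Fin (2 * n)) (Fin (2 * n)) ℚ_[p]} (hg : g ∈ SiegelP p n) :
    iotaMat p n g ∈ SpM p n := by
  obtain ⟨A, B, D, rfl, h1, h2⟩ := exists_blk_of_mem_SiegelP hg
  have h3 : Dᵀ * (wa p n * A) = wa p n := by
    simpa [transpose_mul, wa_transpose, Matrix.mul_assoc] using congrArg transpose h1
  show (iotaMat p n _)ᵀ * Jmat p n * iotaMat p n _ = Jmat p n
  rw [iotaMat_blk]
  have h0 : blk p 0 0 0 0 = (0 : Matrix (Fin (2 * n)) (Fin (2 * n)) ℚ_[p]) := by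
    simp [blk]
  simp [Jmat, wa_two_mul, blk_mul, blk_transpose, ← h0, blk_neg, blk_add, Matrix.mul_assoc, h1, h2, h3]

/-- Moving `w_U ι(g)` past an upper unipotent element of the relevant shape. -/
theorem exists_wU_mul_iotaMat_mul_upperU {g : Matrix (Fin (2 * n)) (Fin (2 * n)) ℚ_[p]}
    (hg : g ∈ SiegelP p n) : ∃ E D : Matrix (Fin n) (Fin n) ℚ_[p], E * D = 1 ∧ ∀ X y,
      wU p n * iotaMat p n g * upperU (zz X y) =
        lowerU (zz (-(X * E)) (-y)) * (wU p n * iotaMat p n g) := by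
  obtain ⟨A, B, D, rfl, h1, -⟩ := exists_blk_of_mem_SiegelP hg
  have hAD : antiT A * D = 1 := by
    rw [antiT, Matrix.mul_assoc, Matrix.mul_assoc, h1, wa_mul_wa]
  refine ⟨antiT A, D, hAD, fun X y => ?_⟩
  rw [iotaMat_blk]
  simp only [wU, upperU, lowerU, blk_mul]
  congr 1
  · simp
  · simp
  · simp
  · simp [zz, blk_mul, blk_neg, blk_add, antiT_neg, antiT_mul, antiT_antiT, Matrix.mul_assoc, hAD]

theorem uDiamond_mul_xPrimeMat (x y : Matrix (Fin n) (Fin n) ℚ_[p]) (a : Fin n → ℚ_[p]) :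
    uDiamond p x y * xPrimeMat p a = upperU (zz (antiT x + lastRowMat p a) y) := by
  have h1 : uDiamond p x y = upperU (zz (antiT x) y) := by
    rw [zz, antiT_antiT]; rfl
  have h2 : xPrimeMat p a = upperU (zz (lastRowMat p a) 0) := rfl
  rw [h1, h2, upperU_mul, zz_add, add_zero]

end SiegelFactor

section UpperTranslate

variable {p : ℕ} [Fact p.Prime] {n : ℕ}

theorem Continuous.blk {T : Type*} [TopologicalSpace T] {k : ℕ}
    {A B C D : T → Matrix (Fin k) (Fin k) ℚ_[p]} (hA : Continuous A) (hB : Continuous B)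
    (hC : Continuous C) (hD : Continuous D) :
    Continuous fun t => _root_.blk p (A t) (B t) (C t) (D t) :=
  (hA.matrix_fromBlocks hB hC hD).matrix_reindex _ _

theorem isUnipUpper_one {k : ℕ} : IsUnipUpper (1 : Matrix (Fin k) (Fin k) ℚ_[p]) :=
  ⟨fun i j h => one_apply_ne (by rintro rfl; exact lt_irrefl _ h), fun i => one_apply_eq i⟩

theorem isUnipUpper_blk {k : ℕ} {A D : Matrix (Fin k) (Fin k) ℚ_[p]} (hA : IsUnipUpper A)
    (hD : IsUnipUpper D) (B : Matrix (Fin k) (Fin k) ℚ_[p]) : IsUnipUpper (blk p A B 0 D) := by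
  constructor
  · intro i j hij
    obtain ⟨i, rfl⟩ := (sumEquiv k).surjective i
    obtain ⟨j, rfl⟩ := (sumEquiv k).surjective j
    rw [blk_apply]
    rcases i with i | i <;> rcases j with j | j
    · exact hA.1 i j (by simpa using hij)
    · simp at hij; omega
    · rfl
    · exact hD.1 i j (by simpa using hij)
  · intro i
    obtain ⟨i, rfl⟩ := (sumEquiv k).surjective i
    rw [blk_apply]
    rcases i with i | i
    · exact hA.2 i
    · exact hD.2 i

theorem sdSumUpTo_blk (N : Matrix (Fin n) (Fin n) ℚ_[p])
    (B D : Matrix (Fin (2 * n)) (Fin (2 * n)) ℚ_[p]) (l : Fin n) (hl : (l : ℕ) = n - 1) :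
    sdSumUpTo (2 * (2 * n)) (2 * n - 1) (blk p (blk p 1 N 0 1) B 0 D) = N l l.rev := by
  have hn := l.2
  have hmem : ∀ i j : Fin n ⊕ Fin n, blk p (blk p 1 N 0 1) B 0 D
      (sumEquiv _ (Sum.inl (sumEquiv n i))) (sumEquiv _ (Sum.inl (sumEquiv n j))) =
      fromBlocks 1 N 0 1 i j := by
    intro i j
    rw [blk_apply, fromBlocks_apply₁₁, blk_apply]
  rw [sdSumUpTo, Fintype.sum_eq_single ⟨n - 1, by omega⟩]
  · rw [dif_pos (by simp only; omega), ← fromBlocks_apply₁₂ (1 : Matrix (Fin n) (Fin n) ℚ_[p]) N 0 (1 : Matrix (Fin n) (Fin n) ℚ_[p]), ← hmem]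
    congr 1 <;> ext <;> simp [hl] <;> omega
  · intro t ht
    have hti : (t : ℕ) ≠ n - 1 := fun h => ht (Fin.ext h)
    have ht2 := t.2
    rw [dif_pos (by omega)]
    rcases lt_or_gt_of_ne hti with h | h
    · trans fromBlocks (1 : Matrix (Fin n) (Fin n) ℚ_[p]) N 0 (1 : Matrix (Fin n) (Fin n) ℚ_[p])
        (Sum.inl ⟨t, by omega⟩) (Sum.inl ⟨t + 1, by omega⟩)
      · rw [← hmem]
        congr 1
      · simp [one_apply]
    · trans fromBlocks (1 : Matrix (Fin n) (Fin n) ℚ_[p]) N 0 (1 : Matrix (Fin n) (Fin n) ℚ_[p])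
        (Sum.inr ⟨t - n, by omega⟩) (Sum.inr ⟨t - n + 1, by omega⟩)
      · rw [← hmem]
        congr 1 <;> ext <;> simp <;> omega
      · simp [one_apply]

/-- The corner matrix with upper right block `s E_{j, j*}`. -/
noncomputable def corner (s : ℚ_[p]) (j : Fin n) : Matrix (Fin (2 * n)) (Fin (2 * n)) ℚ_[p] :=
  blk p 0 (Matrix.single j j.rev s) 0 0

theorem antiT_single (s : ℚ_[p]) (j : Fin n) :
    antiT (Matrix.single j j.rev s) = Matrix.single j j.rev s := by
  ext i k
  rw [antiT_apply, single_apply, single_apply]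
  congr 1
  rw [Fin.rev_inj, Fin.rev_eq_iff, and_comm]

theorem antiT_corner (s : ℚ_[p]) (j : Fin n) : antiT (corner s j) = corner s j := by
  rw [corner, antiT_blk, antiT_single, antiT_zero]

/-- The symmetric matrix with entries `X_{i j} X_{k* j}`. -/
noncomputable def colSquare (X : Matrix (Fin n) (Fin n) ℚ_[p]) (j : Fin n) :
    Matrix (Fin n) (Fin n) ℚ_[p] :=
  of fun i k => X i j * X k.rev j

theorem antiT_colSquare (X : Matrix (Fin n) (Fin n) ℚ_[p]) (j : Fin n) :
    antiT (colSquare X j) = colSquare X j := by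
  ext i k
  simp [antiT_apply, colSquare, mul_comm]

theorem IsWhittaker.exists_corner {ψ : ℚ_[p] → ℂˣ}
    {W : Matrix (Fin (2 * (2 * n))) (Fin (2 * (2 * n))) ℚ_[p] → ℂ} (hW : IsWhittaker ψ W)
    (l : Fin n) (hl : (l : ℕ) = n - 1) :
    ∃ ε > 0, ∀ s : ℚ_[p], ‖s‖ ≤ ε → ∀ (j : Fin n) (X y : Matrix (Fin n) (Fin n) ℚ_[p]),
      antiT y = y → W (lowerU (zz (-X) (-y))) =
        (ψ (s * if j = l then X l j else 0) : ℂ) *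
          W (lowerU (zz (-X) (-(y + s • colSquare X j)))) := by
  have hev : ∀ᶠ s : ℚ_[p] in nhds 0, ∀ j : Fin n, upperU (corner s j) ∈ SpM p n →
      ∀ h ∈ SpM p n, W (h * upperU (corner s j)) = W h := by
    refine Filter.eventually_all.2 fun j => ?_
    have hc : Continuous fun s : ℚ_[p] => upperU (corner s j) := by
      have h1 : Continuous fun s : ℚ_[p] => Matrix.single j j.rev s := by
        refine continuous_matrix fun i k => ?_
        simp only [single_apply]
        split_ifs <;> fun_prop
      exact continuous_const.blk (continuous_const.blk h1 continuous_const continuous_const)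
        continuous_const continuous_const
    have ht := hc.tendsto 0
    have h0 : upperU (corner (0 : ℚ_[p]) j) = 1 := by
      simp [upperU, corner, blk]
    rw [h0] at ht
    exact ht.eventually hW.smooth
  obtain ⟨ε, hε, H⟩ := Metric.nhds_basis_closedBall.eventually_iff.1 hev
  refine ⟨ε, hε, fun s hs j X y hy => ?_⟩
  have hmem := upperU_mem (antiT_corner s j)
  have hny : antiT (-y) = -y := by rw [antiT_neg, hy]
  have hlow := lowerU_mem (antiT_zz (X := -X) hny)
  rw [← H (by simpa using hs) j hmem _ hlow]
  set Q := s • colSquare X j with hQ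
  have hQs : antiT (-(y + Q)) = -(y + Q) := by
    rw [antiT_neg, antiT_add, hy, hQ, antiT, transpose_smul, Matrix.mul_smul, Matrix.smul_mul]
    congr 3
    exact antiT_colSquare X j
  have hlow' := lowerU_mem (antiT_zz (X := -X) hQs)
  set c := Matrix.single j j.rev s with hc
  have hXc : X * c * antiT X = Q := by
    ext i k
    simp [hc, hQ, colSquare, mul_apply, single_apply, antiT_apply, ite_and]
    ring
  set v := blk p (blk p 1 (c * antiT X) 0 1) (corner s j) 0 (blk p 1 (-(X * c)) 0 1) with hv
  have hfac : lowerU (zz (-X) (-y)) * upperU (corner s j) = v * lowerU (zz (-X) (-(y + Q))) := by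
    simp only [hv, lowerU, upperU, corner, zz, ← hc, blk_mul, blk_add, antiT_neg, ← blk_one (k := n)]
    congr 1
    · simp
    · simp
    · simp [← hXc, Matrix.mul_assoc]
    · simp
  have hvmem : v ∈ SpM p n := by
    obtain ⟨h', hh', h1, -⟩ := exists_inv_of_mem_SpM hlow'
    have : v = lowerU (zz (-X) (-y)) * upperU (corner s j) * h' := by
      rw [hfac, Matrix.mul_assoc, h1, Matrix.mul_one]
    rw [this]
    exact mul_mem_SpM (mul_mem_SpM hlow hmem) hh'
  have hu : IsUnipUpper v := isUnipUpper_blk (isUnipUpper_blk isUnipUpper_one isUnipUpper_one _)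
    (isUnipUpper_blk isUnipUpper_one isUnipUpper_one _) _
  rw [hfac, hW.equivariant v hvmem _ hlow' hu, hv, sdSumUpTo_blk _ _ _ l hl]
  congr 4
  simp [hc, antiT_apply, mul_apply, single_apply, ite_and]

end UpperTranslate

section Shear

variable {G H : Type*} [AddCommGroup G] [TopologicalSpace G] [IsTopologicalAddGroup G]
  [LocallyCompactSpace G] [SecondCountableTopology G] [MeasurableSpace G] [BorelSpace G]
  [AddCommGroup H] [TopologicalSpace H] [IsTopologicalAddGroup H]
  [LocallyCompactSpace H] [SecondCountableTopology H] [MeasurableSpace H] [BorelSpace H]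

theorem measurePreserving_add_snd (μ : Measure (G × H)) [μ.IsAddHaarMeasure] {θ : G → H}
    (hθ : Continuous θ) : MeasurePreserving (fun v : G × H => (v.1, v.2 + θ v.1)) μ μ := by
  rw [Measure.isAddLeftInvariant_eq_smul μ
    ((Measure.addHaar : Measure G).prod (Measure.addHaar : Measure H))]
  refine MeasurePreserving.smul_measure ?_ _
  refine (MeasurePreserving.id _).skew_product (g := fun a c => c + θ a) ?_
    (Filter.Eventually.of_forall fun a => ?_)
  · exact (continuous_snd.add (hθ.comp continuous_fst)).measurable
  · exact map_add_right_eq_self _ _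

theorem integral_add_snd (μ : Measure (G × H)) [μ.IsAddHaarMeasure] {θ : G → H}
    (hθ : Continuous θ) (f : G × H → ℂ) :
    ∫ v, f (v.1, v.2 + θ v.1) ∂μ = ∫ v, f v ∂μ := by
  let e : G × H ≃ₜ G × H :=
    { toFun := fun v => (v.1, v.2 + θ v.1)
      invFun := fun v => (v.1, v.2 - θ v.1)
      left_inv := fun v => by simp
      right_inv := fun v => by simp
      continuous_toFun := by fun_prop
      continuous_invFun := by fun_prop }
  exact (measurePreserving_add_snd μ hθ).integral_comp e.measurableEmbedding f

end Shear

section UnipotentDomain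

variable {p : ℕ} [Fact p.Prime] {n : ℕ}

theorem isClosed_RnSub : IsClosed (RnSub p n : Set (Matrix (Fin n) (Fin n) ℚ_[p])) := by
  have : (RnSub p n : Set (Matrix (Fin n) (Fin n) ℚ_[p])) =
      ⋂ i : Fin n, ⋂ j : Fin n, ⋂ _ : (j : ℕ) = 0, {x | x i j = 0} := by
    ext x
    simp only [Set.mem_iInter]
    rfl
  rw [this]
  exact isClosed_iInter fun i => isClosed_iInter fun j => isClosed_iInter fun _ =>
    isClosed_eq (continuous_id.matrix_elem i j) continuous_const

theorem continuous_antiT : Continuous (antiT : Matrix (Fin n) (Fin n) ℚ_[p] → _) := by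
  unfold antiT
  fun_prop

theorem isClosed_SnSub : IsClosed (SnSub p n : Set (Matrix (Fin n) (Fin n) ℚ_[p])) :=
  isClosed_eq continuous_antiT continuous_id

instance : LocallyCompactSpace (Matrix (Fin n) (Fin n) ℚ_[p]) :=
  inferInstanceAs (LocallyCompactSpace (Fin n → Fin n → ℚ_[p]))

instance : SecondCountableTopology (Matrix (Fin n) (Fin n) ℚ_[p]) :=
  inferInstanceAs (SecondCountableTopology (Fin n → Fin n → ℚ_[p]))

instance : BorelSpace (Matrix (Fin n) (Fin n) ℚ_[p]) :=
  inferInstanceAs (BorelSpace (Fin n → Fin n → ℚ_[p]))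

instance : LocallyCompactSpace (RnSub p n) := isClosed_RnSub.locallyCompactSpace

instance : LocallyCompactSpace (SnSub p n) := isClosed_SnSub.locallyCompactSpace

instance : SecondCountableTopology (RnSub p n) :=
  TopologicalSpace.Subtype.secondCountableTopology _

instance : SecondCountableTopology (SnSub p n) :=
  TopologicalSpace.Subtype.secondCountableTopology _

theorem isCompact_setOf_norm_le (B : ℝ) :
    IsCompact {v : RnSub p n × SnSub p n | ∀ i k, ‖v.1.1 i k‖ ≤ B ∧ ‖v.2.1 i k‖ ≤ B} := by
  have hK : IsCompact (Set.univ.pi fun _ : Fin n => Set.univ.pi fun _ : Fin n =>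
      Metric.closedBall (0 : ℚ_[p]) B) :=
    isCompact_univ_pi fun _ => isCompact_univ_pi fun _ => isCompact_closedBall _ _
  have he : Topology.IsClosedEmbedding fun v : RnSub p n × SnSub p n => (v.1.1, v.2.1) :=
    (isClosed_RnSub (p := p) (n := n)).isClosedEmbedding_subtypeVal.prodMap
      (isClosed_SnSub (p := p) (n := n)).isClosedEmbedding_subtypeVal
  convert he.isCompact_preimage (hK.prod hK) using 1
  ext v
  simp only [Set.mem_ofPred_eq, forall_and]
  exact ⟨fun h => ⟨fun i _ k _ => mem_closedBall_zero_iff.2 (h.1 i k),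
      fun i _ k _ => mem_closedBall_zero_iff.2 (h.2 i k)⟩,
    fun h => ⟨fun i k => mem_closedBall_zero_iff.1 (h.1 i trivial k trivial),
      fun i k => mem_closedBall_zero_iff.1 (h.2 i trivial k trivial)⟩⟩

theorem norm_vecMul_le {B : ℝ} {v : Fin n → ℚ_[p]} (hv : ∀ i, ‖v i‖ ≤ B)
    (D : Matrix (Fin n) (Fin n) ℚ_[p]) (k : Fin n) :
    ‖(v ᵥ* D) k‖ ≤ B * ∑ i, ∑ j, ‖D i j‖ := by
  rw [vecMul, dotProduct, Finset.mul_sum]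
  refine (norm_sum_le _ _).trans (Finset.sum_le_sum fun i _ => ?_)
  rw [norm_mul]
  refine mul_le_mul (hv i) ?_ (norm_nonneg _) ((norm_nonneg _).trans (hv i))
  exact Finset.single_le_sum (f := fun j => ‖D i j‖) (fun _ _ => norm_nonneg _) (Finset.mem_univ k)

end UnipotentDomain

section CompactSupport

variable {p : ℕ} [Fact p.Prime] {n : ℕ}

theorem hasCompactSupport_of_norm_le {F : RnSub p n × SnSub p n → ℂ} {B : ℝ}
    (hF : ∀ v, F v ≠ 0 → ∀ i k, ‖v.1.1 i k‖ ≤ B ∧ ‖v.2.1 i k‖ ≤ B) : HasCompactSupport F :=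
  HasCompactSupport.intro (isCompact_setOf_norm_le B) fun v hv => by
    by_contra h
    exact hv (hF v h)

theorem lastRowMat_apply (a : Fin n → ℚ_[p]) (i j : Fin n) :
    lastRowMat p a i j = if (i : ℕ) = n - 1 then a j else 0 := rfl

theorem antiT_add_lastRowMat_mul_apply (x : RnSub p n) (a : Fin n → ℚ_[p])
    (E : Matrix (Fin n) (Fin n) ℚ_[p]) {l : Fin n} (hl : (l : ℕ) = n - 1) (k : Fin n) :
    ((antiT x.1 + lastRowMat p a) * E) l k = (a ᵥ* E) k := by
  rw [mul_apply, vecMul, dotProduct]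
  refine Finset.sum_congr rfl fun j _ => ?_
  rw [Matrix.add_apply, antiT_apply, x.2 _ _ (by rw [Fin.val_rev]; omega), zero_add, lastRowMat_apply,
    if_pos hl]

theorem psiDiamondArg_eq (x y : Matrix (Fin n) (Fin n) ℚ_[p]) {l : Fin n} (hl : (l : ℕ) = n - 1) :
    psiDiamondArg p x y = 2⁻¹ * y l l.rev := by
  have hn := l.2
  rw [psiDiamondArg, dif_pos (by omega)]
  congr 1
  have h1 : (⟨n - 1, by omega⟩ : Fin (2 * n)) = sumEquiv n (Sum.inl l) := by
    ext; simp [hl]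
  have h2 : (⟨n, by omega⟩ : Fin (2 * n)) = sumEquiv n (Sum.inr l.rev) := by
    ext; simp [Fin.val_rev]; omega
  rw [h1, h2, zDiam, blk_apply, fromBlocks_apply₁₂]

theorem norm_le_of_add_half_sq (t : ℚ_[p]) (P : Prop) [Decidable P] {C : ℝ}
    (h : ‖(if P then t else 0) + 2⁻¹ * t ^ 2‖ ≤ C) : ‖t‖ ≤ max 2 C := by
  by_contra! hlt
  obtain ⟨h2, hC⟩ := max_lt_iff.1 hlt
  have h3 : ‖(if P then t else 0 : ℚ_[p])‖ ≤ ‖t‖ := by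
    split_ifs
    · rfl
    · simp
  have h4 : 1 ≤ ‖(2⁻¹ : ℚ_[p])‖ := by
    rw [norm_inv]
    refine one_le_inv_iff₀.2 ⟨norm_pos_iff.2 two_ne_zero, ?_⟩
    exact_mod_cast Padic.norm_int_le_one (p := p) 2
  have h5 : ‖2⁻¹ * t ^ 2‖ ≤ C + ‖t‖ := by
    calc ‖2⁻¹ * t ^ 2‖ = ‖((if P then t else 0) + 2⁻¹ * t ^ 2) - (if P then t else 0)‖ := by
          rw [add_sub_cancel_left]
      _ ≤ _ := norm_sub_le _ _
      _ ≤ _ := add_le_add h h3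
  rw [norm_mul, norm_pow] at h5
  nlinarith [sq_nonneg ‖t‖]

/-- Compactness of the support in the unipotent variable. -/
theorem IsWhittaker.hasCompactSupport {ψ : ℚ_[p] → ℂˣ} (hψ : ∃ a, ψ a ≠ 1) (hn : 1 ≤ n)
    {W : Matrix (Fin (2 * (2 * n))) (Fin (2 * (2 * n))) ℚ_[p] → ℂ} (hW : IsWhittaker ψ W)
    {E D : Matrix (Fin n) (Fin n) ℚ_[p]} (hED : E * D = 1) (a : Fin n → ℚ_[p]) :
    HasCompactSupport fun v : RnSub p n × SnSub p n =>
      W (lowerU (zz (-((antiT v.1.1 + lastRowMat p a) * E)) (-v.2.1))) := by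
  have hκ : lowerU (zz (-(lastRowMat p a * E)) 0) ∈ SpM p n :=
    lowerU_mem (antiT_zz (antiT_zero n))
  obtain ⟨B, hB⟩ := (hW.translate hκ).exists_bound hψ hn
  refine hasCompactSupport_of_norm_le (B := max B (B * ∑ i, ∑ j, ‖D i j‖)) fun v hv i k => ?_
  have hbd := hB (-(antiT v.1.1 * E)) (-v.2.1) (fun i k hi => ?_)
    (by rw [antiT_neg, show antiT v.2.1 = v.2.1 from v.2.2]) ?_
  · refine ⟨le_max_of_le_right ?_, le_max_of_le_left (by simpa using (hbd i k).2)⟩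
    have h1 : v.1.1 i k = ((fun j => (antiT v.1.1 * E) k.rev j) ᵥ* D) i.rev := by
      have h2 : antiT v.1.1 k.rev i.rev = (antiT v.1.1 * E * D) k.rev i.rev := by
        rw [Matrix.mul_assoc, hED, Matrix.mul_one]
      rw [antiT_apply, Fin.rev_rev, Fin.rev_rev] at h2
      rw [h2, mul_apply, vecMul, dotProduct]
    rw [h1]
    exact norm_vecMul_le (fun j => by simpa using (hbd k.rev j).1) D _
  · have := antiT_add_lastRowMat_mul_apply v.1 0 E hi k
    rw [zero_vecMul, show lastRowMat p (0 : Fin n → ℚ_[p]) = 0 by ext; simp [lastRowMat_apply],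
      add_zero] at this
    simp [this]
  · rwa [lowerU_mul, zz_add, add_zero, ← neg_add, ← Matrix.add_mul]

/-- The integral over the unipotent variable is compactly supported in the last row. -/
theorem IsWhittaker.hasCompactSupport_integral {ψ : ℚ_[p] → ℂˣ}
    (hψ_add : ∀ a b : ℚ_[p], ψ (a + b) = ψ a * ψ b) (hψ : ∃ a, ψ a ≠ 1) (hn : 1 ≤ n)
    {W : Matrix (Fin (2 * (2 * n))) (Fin (2 * (2 * n))) ℚ_[p] → ℂ} (hW : IsWhittaker ψ W)
    {E D : Matrix (Fin n) (Fin n) ℚ_[p]} (hED : E * D = 1)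
    (μ : Measure (RnSub p n × SnSub p n)) [μ.IsAddHaarMeasure] :
    HasCompactSupport fun a : Fin n → ℚ_[p] => ∫ v : RnSub p n × SnSub p n,
      W (lowerU (zz (-((antiT v.1.1 + lastRowMat p a) * E)) (-v.2.1))) *
        (ψ (psiDiamondArg p v.1.1 v.2.1) : ℂ)⁻¹ ∂μ := by
  set l : Fin n := ⟨n - 1, by omega⟩ with hl
  obtain ⟨ε, hε, H⟩ := hW.exists_corner l rfl
  obtain ⟨s₁, hs₁⟩ := hψ
  set C := max 2 (‖s₁‖ / ε)
  refine HasCompactSupport.intro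
    (K := Set.univ.pi fun _ => Metric.closedBall (0 : ℚ_[p]) (C * ∑ i, ∑ j, ‖D i j‖))
    (isCompact_univ_pi fun _ => isCompact_closedBall _ _) fun a ha => ?_
  by_contra hne
  refine ha fun k _ => mem_closedBall_zero_iff.2 ?_
  have hak : a = (a ᵥ* E) ᵥ* D := by rw [vecMul_vecMul, hED, vecMul_one]
  rw [hak]
  refine norm_vecMul_le (fun j => norm_le_of_add_half_sq _ (j = l)
    (norm_le_of_forall_eq_one hs₁ hε fun s hs => ?_)) D k
  let X : RnSub p n → Matrix (Fin n) (Fin n) ℚ_[p] := fun x => (antiT x.1 + lastRowMat p a) * E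
  let θ : RnSub p n → SnSub p n := fun x => ⟨s • colSquare (X x) j, by
    change antiT _ = _
    rw [antiT, transpose_smul, Matrix.mul_smul, Matrix.smul_mul]
    congr 1
    exact antiT_colSquare _ _⟩
  have hX : Continuous X :=
    ((continuous_antiT.comp continuous_subtype_val).add continuous_const).matrix_mul
      continuous_const
  have hθ : Continuous θ := by
    refine Continuous.subtype_mk (Continuous.const_smul ?_ s) _
    exact continuous_matrix fun i k => (hX.matrix_elem i j).mul (hX.matrix_elem k.rev j)
  have hint := integral_add_snd μ hθ fun v : RnSub p n × SnSub p n =>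
      W (lowerU (zz (-((antiT v.1.1 + lastRowMat p a) * E)) (-v.2.1))) *
        (ψ (psiDiamondArg p v.1.1 v.2.1) : ℂ)⁻¹
  set u : ℚ_[p] := (a ᵥ* E) j with hu
  set lam := (if j = l then u else 0) + 2⁻¹ * u ^ 2 with hlam
  have hF : ∀ v : RnSub p n × SnSub p n,
      W (lowerU (zz (-((antiT v.1.1 + lastRowMat p a) * E)) (-v.2.1))) *
        (ψ (psiDiamondArg p v.1.1 v.2.1) : ℂ)⁻¹ = (ψ (s * lam) : ℂ) *
      (W (lowerU (zz (-((antiT v.1.1 + lastRowMat p a) * E)) (-(v.2 + θ v.1).1))) *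
        (ψ (psiDiamondArg p v.1.1 (v.2 + θ v.1).1) : ℂ)⁻¹) := by
    intro v
    have hXl := antiT_add_lastRowMat_mul_apply v.1 a E (l := l) rfl j
    rw [H s hs j _ _ v.2.2, hXl, ← hu]
    have h1 : psiDiamondArg p v.1.1 (v.2 + θ v.1).1 =
        psiDiamondArg p v.1.1 v.2.1 + s * (2⁻¹ * u ^ 2) := by
      rw [psiDiamondArg_eq _ _ (l := l) rfl, psiDiamondArg_eq _ _ (l := l) rfl]
      have h2 : (θ v.1).1 l l.rev = s * u ^ 2 := by
        change s • (X v.1 l j * X v.1 l.rev.rev j) = _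
        rw [Fin.rev_rev, show X v.1 l j = u from hXl, smul_eq_mul, pow_two]
      rw [AddSubgroup.coe_add, Matrix.add_apply, h2]
      ring
    rw [h1, hlam, mul_add, hψ_add, hψ_add, Units.val_mul, Units.val_mul]
    have e1 := (ψ (psiDiamondArg p v.1.1 v.2.1)).ne_zero
    have e2 := (ψ (s * (2⁻¹ * u ^ 2))).ne_zero
    field_simp
    rfl
  have hI := integral_congr_ae (μ := μ) (Filter.Eventually.of_forall hF)
  rw [integral_const_mul] at hI
  refine Units.val_injective (mul_right_cancel₀ hne ?_)
  rw [Units.val_one, one_mul]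
  refine Eq.trans ?_ hI.symm
  congr 1
  exact hint.symm

end CompactSupport

section LastRow

variable {p : ℕ} [Fact p.Prime] {n : ℕ}

theorem xPrimeMat_eq_upperU (a : Fin n → ℚ_[p]) : xPrimeMat p a = upperU (zz (lastRowMat p a) 0) :=
  rfl

theorem lastRowMat_add (a b : Fin n → ℚ_[p]) :
    lastRowMat p (a + b) = lastRowMat p a + lastRowMat p b := by
  ext i j
  rw [Matrix.add_apply, lastRowMat_apply, lastRowMat_apply, lastRowMat_apply]
  split_ifs <;> simp

theorem xPrimeMat_add (a b : Fin n → ℚ_[p]) :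
    xPrimeMat p (a + b) = xPrimeMat p a * xPrimeMat p b := by
  simp only [xPrimeMat_eq_upperU, upperU_mul, zz_add, add_zero, lastRowMat_add]

theorem xPrimeMat_mem (a : Fin n → ℚ_[p]) : xPrimeMat p a ∈ SpM p n :=
  upperU_mem (antiT_zz (antiT_zero n))

theorem continuous_xPrimeMat : Continuous fun a : Fin n → ℚ_[p] => xPrimeMat p a := by
  have h : Continuous fun a : Fin n → ℚ_[p] => lastRowMat p a := by
    refine continuous_matrix fun i j => ?_
    simp only [lastRowMat_apply]
    split_ifs <;> fun_prop
  exact continuous_const.blk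
    (h.blk continuous_const continuous_const (continuous_antiT.comp h))
    continuous_const continuous_const

theorem xPrimeMat_zero : xPrimeMat p (0 : Fin n → ℚ_[p]) = 1 := by
  have h : lastRowMat p (0 : Fin n → ℚ_[p]) = 0 := by ext; simp [lastRowMat_apply]
  simp [xPrimeMat_eq_upperU, h, upperU, zz, blk, antiT]

theorem uDiamond_mem (v : RnSub p n × SnSub p n) : uDiamond p v.1.1 v.2.1 ∈ SpM p n := by
  have h := uDiamond_mul_xPrimeMat v.1.1 v.2.1 0
  rw [xPrimeMat_zero, Matrix.mul_one] at h
  rw [h]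
  exact upperU_mem (antiT_zz v.2.2)

theorem continuous_uDiamond :
    Continuous fun v : RnSub p n × SnSub p n => uDiamond p v.1.1 v.2.1 :=
  have h : Continuous fun v : RnSub p n × SnSub p n => v.1.1 :=
    continuous_subtype_val.comp continuous_fst
  continuous_const.blk
    ((continuous_antiT.comp h).blk (continuous_subtype_val.comp continuous_snd)
      continuous_const h) continuous_const continuous_const

theorem continuous_psiDiamondArg (hn : 1 ≤ n) :
    Continuous fun v : RnSub p n × SnSub p n => psiDiamondArg p v.1.1 v.2.1 := by
  simp only [psiDiamondArg_eq _ _ (l := ⟨n - 1, by omega⟩) rfl]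
  have h : Continuous fun v : RnSub p n × SnSub p n => v.2.1 :=
    continuous_subtype_val.comp continuous_snd
  exact continuous_const.mul (h.matrix_elem _ _)

/-- A function invariant under small translations is continuous. -/
theorem continuous_of_eventually_add_eq {A : Type*} [AddGroup A] [TopologicalSpace A]
    [IsTopologicalAddGroup A] {f : A → ℂ} (h : ∀ᶠ d in nhds 0, ∀ a, f (a + d) = f a) :
    Continuous f := by
  rw [continuous_iff_continuousAt]
  intro a
  have ht : Filter.Tendsto (fun b => -a + b) (nhds a) (nhds 0) := by
    have : Continuous fun b => -a + b := by fun_prop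
    simpa using this.tendsto a
  refine (continuousAt_const (y := f a)).congr ((ht.eventually h).mono fun b hb => ?_)
  simpa using (hb a).symm

end LastRow

/-- **Lemma 4.3, part 1.**  For a smooth continuous `(N, ψ_N)`-equivariant function `W` on `G`
and `g ∈ P'`: (i) for each `x ∈ X'ₙ` the function `v ↦ W(w_U ι(g) v x)` on `U_♦ ≅ Rₙ × Sₙ` has
compact support (and the integrand `W(w_U ι(g) v x) ψ_♦(v)⁻¹` is integrable), and (ii) the
function `x ↦ ∫_{U_♦} W(w_U ι(g) v x) ψ_♦(v)⁻¹ dv` on `X'ₙ ≅ ℚ_p^n` has compact support (and is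
integrable); hence the iterated integral converges. -/
theorem lemma_4_3_part_1
    (p : ℕ) [Fact p.Prime] (n : ℕ) (hn : 1 ≤ n)
    (ψ : ℚ_[p] → ℂˣ)
    (hψ_add : ∀ a b : ℚ_[p], ψ (a + b) = ψ a * ψ b)
    (hψ_cont : Continuous ψ)
    (hψ_ne : ∃ a : ℚ_[p], ψ a ≠ 1)
    (μ : Measure (↥(RnSub p n) × ↥(SnSub p n))) [μ.IsAddHaarMeasure]
    (ν : Measure (Fin n → ℚ_[p])) [ν.IsAddHaarMeasure]
    (W : Matrix (Fin (2 * (2 * n))) (Fin (2 * (2 * n))) ℚ_[p] → ℂ)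
    (hW_cont : ContinuousOn W (SpM p n))
    (hW_smooth : ∃ S : Set (Matrix (Fin (2 * (2 * n))) (Fin (2 * (2 * n))) ℚ_[p]),
      S ⊆ SpM p n ∧ IsCompact S ∧
      (∃ V, IsOpen V ∧ S = V ∩ SpM p n) ∧
      (1 ∈ S) ∧ (∀ a ∈ S, ∀ b ∈ S, a * b ∈ S) ∧
      (∀ a ∈ S, ∃ b ∈ S, a * b = 1 ∧ b * a = 1) ∧
      ∀ g ∈ SpM p n, ∀ k ∈ S, W (g * k) = W g)
    (hW_equiv : ∀ v g : Matrix (Fin (2 * (2 * n))) (Fin (2 * (2 * n))) ℚ_[p],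
      v ∈ SpM p n → g ∈ SpM p n → IsUnipUpper v →
      W (v * g) = (ψ (sdSumUpTo (2 * (2 * n)) (2 * n - 1) v) : ℂ) * W g)
    (g : Matrix (Fin (2 * n)) (Fin (2 * n)) ℚ_[p]) (hg : g ∈ SiegelP p n) :
    (∀ a : Fin n → ℚ_[p],
      HasCompactSupport (fun v : ↥(RnSub p n) × ↥(SnSub p n) =>
        W (wU p n * iotaMat p n g *
            uDiamond p (v.1 : Matrix (Fin n) (Fin n) ℚ_[p]) (v.2 : Matrix (Fin n) (Fin n) ℚ_[p]) *
            xPrimeMat p a))) ∧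
    (∀ a : Fin n → ℚ_[p],
      Integrable (fun v : ↥(RnSub p n) × ↥(SnSub p n) =>
        W (wU p n * iotaMat p n g *
            uDiamond p (v.1 : Matrix (Fin n) (Fin n) ℚ_[p]) (v.2 : Matrix (Fin n) (Fin n) ℚ_[p]) *
            xPrimeMat p a) *
          ((ψ (psiDiamondArg p (v.1 : Matrix (Fin n) (Fin n) ℚ_[p])
              (v.2 : Matrix (Fin n) (Fin n) ℚ_[p])) : ℂ))⁻¹) μ) ∧
    HasCompactSupport (fun a : Fin n → ℚ_[p] =>
      ∫ v : ↥(RnSub p n) × ↥(SnSub p n),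
        W (wU p n * iotaMat p n g *
            uDiamond p (v.1 : Matrix (Fin n) (Fin n) ℚ_[p]) (v.2 : Matrix (Fin n) (Fin n) ℚ_[p]) *
            xPrimeMat p a) *
          ((ψ (psiDiamondArg p (v.1 : Matrix (Fin n) (Fin n) ℚ_[p])
              (v.2 : Matrix (Fin n) (Fin n) ℚ_[p])) : ℂ))⁻¹ ∂μ) ∧
    Integrable (fun a : Fin n → ℚ_[p] =>
      ∫ v : ↥(RnSub p n) × ↥(SnSub p n),
        W (wU p n * iotaMat p n g *
            uDiamond p (v.1 : Matrix (Fin n) (Fin n) ℚ_[p]) (v.2 : Matrix (Fin n) (Fin n) ℚ_[p]) *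
            xPrimeMat p a) *
          ((ψ (psiDiamondArg p (v.1 : Matrix (Fin n) (Fin n) ℚ_[p])
              (v.2 : Matrix (Fin n) (Fin n) ℚ_[p])) : ℂ))⁻¹ ∂μ) ν := by
  obtain ⟨S, -, -, ⟨V, hVo, rfl⟩, h1, -, -, hS⟩ := hW_smooth
  have hW : IsWhittaker ψ W :=
    ⟨(hVo.eventually_mem h1.1).mono fun r hr hrS h hh => hS h hh r ⟨hr, hrS⟩,
      fun v hv h hh hu => hW_equiv v h hv hh hu⟩
  set γ := wU p n * iotaMat p n g with hγ
  have hγm : γ ∈ SpM p n := mul_mem_SpM wU_mem (iotaMat_mem hg)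
  obtain ⟨E, D, hED, hfac⟩ := exists_wU_mul_iotaMat_mul_upperU hg
  have hL := hW.translate hγm
  have hrw : ∀ (a : Fin n → ℚ_[p]) (v : ↥(RnSub p n) × ↥(SnSub p n)),
      W (γ * uDiamond p v.1.1 v.2.1 * xPrimeMat p a) =
        W (lowerU (zz (-((antiT v.1.1 + lastRowMat p a) * E)) (-v.2.1)) * γ) := by
    intro a v
    rw [Matrix.mul_assoc, uDiamond_mul_xPrimeMat, hfac]
  have hcs : ∀ a : Fin n → ℚ_[p], HasCompactSupport fun v : ↥(RnSub p n) × ↥(SnSub p n) =>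
      W (γ * uDiamond p v.1.1 v.2.1 * xPrimeMat p a) := by
    intro a
    simp only [hrw]
    exact hL.hasCompactSupport hψ_ne hn hED a
  have hcont : ∀ a : Fin n → ℚ_[p], Continuous fun v : ↥(RnSub p n) × ↥(SnSub p n) =>
      W (γ * uDiamond p v.1.1 v.2.1 * xPrimeMat p a) := fun a =>
    hW_cont.comp_continuous
      ((continuous_const.matrix_mul continuous_uDiamond).matrix_mul continuous_const)
      fun v => mul_mem_SpM (mul_mem_SpM hγm (uDiamond_mem v)) (xPrimeMat_mem a)
  have hψc : Continuous fun v : ↥(RnSub p n) × ↥(SnSub p n) =>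
      ((ψ (psiDiamondArg p v.1.1 v.2.1) : ℂ))⁻¹ :=
    (Units.continuous_val.comp (hψ_cont.comp (continuous_psiDiamondArg hn))).inv₀
      fun v => Units.ne_zero _
  have hcs2 : HasCompactSupport fun a : Fin n → ℚ_[p] => ∫ v : ↥(RnSub p n) × ↥(SnSub p n),
      W (γ * uDiamond p v.1.1 v.2.1 * xPrimeMat p a) *
        ((ψ (psiDiamondArg p v.1.1 v.2.1) : ℂ))⁻¹ ∂μ := by
    simp only [hrw]
    exact hL.hasCompactSupport_integral hψ_add hψ_ne hn hED μ
  refine ⟨hcs, fun a => ((hcont a).mul hψc).integrable_of_hasCompactSupport (hcs a).mul_right,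
    hcs2, Continuous.integrable_of_hasCompactSupport (continuous_of_eventually_add_eq ?_) hcs2⟩
  have ht := continuous_xPrimeMat.tendsto (0 : Fin n → ℚ_[p])
  rw [xPrimeMat_zero] at ht
  refine (ht.eventually hW.smooth).mono fun d hd a => integral_congr_ae (.of_forall fun v => ?_)
  simp only
  rw [xPrimeMat_add, ← Matrix.mul_assoc, hd (xPrimeMat_mem d) _
    (mul_mem_SpM (mul_mem_SpM hγm (uDiamond_mem v)) (xPrimeMat_mem a))]
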